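/- arXiv:0806.0168 — 5 statements merged into one kernel-verified Lean document; each statement's English description precedes it below -/
import Mathlib

section
/- Let d be an integer with 2 ≤ d ≤ 5, and let A, B be invertible d×d complex matrices satisfying the braid relation A*B*A = B*A*B, such that the pair (A,B) is irreducible. If the subgroup G of GL(d,ℂ) generated by A and B is finite, then A has d pairwise distinct eigenvalues, and every eigenvalue of A is a root of unity. -/
/-- The pair of matrices `(A, B)` acting on `ℂ^d` is irreducible if the only subspaces
invariant under both `A` and `B` are `0` and all of `ℂ^d`. -/
def MatPairIrreducible {d : ℕ} (A B : Matrix (Fin d) (Fin d) ℂ) : Prop :=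
  ∀ W : Submodule ℂ (Fin d → ℂ),
    (∀ v ∈ W, A.mulVec v ∈ W) → (∀ v ∈ W, B.mulVec v ∈ W) → W = ⊥ ∨ W = ⊤

/-- The subgroup of `GL(d, ℂ)` generated by the (invertible) matrices `A` and `B`. -/
def matGenGroup {d : ℕ} (A B : Matrix (Fin d) (Fin d) ℂ) :
    Subgroup (Matrix (Fin d) (Fin d) ℂ)ˣ :=
  Subgroup.closure {g : (Matrix (Fin d) (Fin d) ℂ)ˣ |
    (g : Matrix (Fin d) (Fin d) ℂ) = A ∨ (g : Matrix (Fin d) (Fin d) ℂ) = B}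

open Matrix Module

/-- A matrix of finite order over `ℂ` is diagonalizable. -/
theorem exists_mul_eq_mul_diagonal_of_pow_eq_one {d n : ℕ} (hn : 0 < n)
    (T : Matrix (Fin d) (Fin d) ℂ) (hT : T ^ n = 1) :
    ∃ (P : (Matrix (Fin d) (Fin d) ℂ)ˣ) (f : Fin d → ℂ), T * P = P * diagonal f := by
  have hss : End.IsSemisimple (toLin' T) := by
    refine End.isSemisimple_of_squarefree_aeval_eq_zero (p := Polynomial.X ^ n - 1)
      (Polynomial.separable_X_pow_sub_C (1 : ℂ) (by exact_mod_cast hn.ne') one_ne_zero).squarefree ?_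
    simp [← toLin'_pow, hT, ← End.one_eq_id]
  set s : Set (Fin d → ℂ) := {v | ∃ μ : ℂ, T *ᵥ v = μ • v}
  have hs : ⊤ ≤ Submodule.span ℂ s := by
    rw [← hss.iSup_eigenspace_eq_top]
    refine iSup_le fun μ v hv => Submodule.subset_span ⟨μ, ?_⟩
    simpa using End.mem_eigenspace_iff.mp hv
  let b₀ := Basis.ofSpan hs
  have : Fintype ((linearIndepOn_empty ℂ id).extend (Set.empty_subset s)) :=
    FiniteDimensional.fintypeBasisIndex b₀
  let b : Basis (Fin d) ℂ (Fin d → ℂ) :=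
    b₀.reindex (Fintype.equivFinOfCardEq (by rw [← finrank_eq_card_basis b₀]; simp))
  have hb (i : Fin d) : ∃ μ : ℂ, T *ᵥ b i = μ • b i := by
    have : b i ∈ s := by
      apply Basis.ofSpan_subset hs
      simp [b, b₀]
    exact this
  choose f hf using hb
  let := (Pi.basisFun ℂ (Fin d)).invertibleToMatrix b
  refine ⟨unitOfInvertible ((Pi.basisFun ℂ (Fin d)).toMatrix b), f, ?_⟩
  ext i j
  have := congrFun (hf j) i
  rw [val_unitOfInvertible, mul_diagonal]
  simpa [mul_apply, mulVec, dotProduct, Basis.toMatrix_apply, mul_comm] using this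

/-- The space of matrices commuting with `T`. -/
noncomputable def commutantSubmodule {d : ℕ} (T : Matrix (Fin d) (Fin d) ℂ) :
    Submodule ℂ (Matrix (Fin d) (Fin d) ℂ) :=
  LinearMap.ker (LinearMap.mulLeft ℂ T - LinearMap.mulRight ℂ T)

theorem mem_commutantSubmodule {d : ℕ} {T X : Matrix (Fin d) (Fin d) ℂ} :
    X ∈ commutantSubmodule T ↔ T * X = X * T := by
  simp [commutantSubmodule, sub_eq_zero]

theorem card_eq_pairs_le_finrank_commutantSubmodule {d : ℕ} (T : Matrix (Fin d) (Fin d) ℂ)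
    (P : (Matrix (Fin d) (Fin d) ℂ)ˣ) (f : Fin d → ℂ) (h : T * P = P * diagonal f) :
    Fintype.card {p : Fin d × Fin d // f p.1 = f p.2} ≤ finrank ℂ (commutantSubmodule T) := by
  let L : ({p : Fin d × Fin d // f p.1 = f p.2} → ℂ) →ₗ[ℂ] Matrix (Fin d) (Fin d) ℂ :=
    { toFun := fun g => of fun i j => if hij : f i = f j then g ⟨(i, j), hij⟩ else 0
      map_add' := fun g g' => by ext i j; by_cases hij : f i = f j <;> simp [hij]
      map_smul' := fun c g => by ext i j; simp }
  let R := LinearMap.mulLeft ℂ (P : Matrix (Fin d) (Fin d) ℂ) ∘ₗ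
    LinearMap.mulRight ℂ ((P⁻¹ : (Matrix (Fin d) (Fin d) ℂ)ˣ) : Matrix (Fin d) (Fin d) ℂ) ∘ₗ L
  have hT : T = P * diagonal f * (P⁻¹ : (Matrix (Fin d) (Fin d) ℂ)ˣ) := by
    rw [← h, Units.mul_inv_cancel_right]
  have hR (g) : R g ∈ commutantSubmodule T := by
    have hL : diagonal f * L g = L g * diagonal f := by
      ext i j
      rw [diagonal_mul, mul_diagonal]
      by_cases hij : f i = f j <;> simp [L, hij, mul_comm]
    rw [mem_commutantSubmodule, hT]
    simp only [R, LinearMap.comp_apply, LinearMap.mulLeft_apply, LinearMap.mulRight_apply]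
    simp only [mul_assoc, Units.inv_mul_cancel_left]
    rw [← mul_assoc (diagonal f), hL, mul_assoc]
  have hinj : Function.Injective (R.codRestrict _ hR) := by
    intro g g' hgg
    have h1 : R g = R g' := congrArg Subtype.val hgg
    have h2 : L g = L g' := by
      simp only [R, LinearMap.comp_apply, LinearMap.mulLeft_apply, LinearMap.mulRight_apply] at h1
      exact (Units.mul_left_inj _).1 ((Units.mul_right_inj _).1 h1)
    ext ⟨⟨i, j⟩, hij⟩
    have := congrFun (congrFun h2 i) j
    simp only [L, LinearMap.coe_mk, AddHom.coe_mk, of_apply] at this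
    simpa [show f i = f j from hij] using this
  simpa using LinearMap.finrank_le_finrank_of_injective hinj

theorem sq_le_mul_card_eq_pairs {d k : ℕ} (hk : 0 < k) (c : ℂ) (f : Fin d → ℂ)
    (hf : ∀ i, f i ^ k = c) :
    d ^ 2 ≤ k * Fintype.card {p : Fin d × Fin d // f p.1 = f p.2} := by
  let t := (Polynomial.nthRoots k c).toFinset
  have ht : t.card ≤ k :=
    (Multiset.toFinset_card_le _).trans (Polynomial.card_nthRoots k c)
  have hmem (i : Fin d) : f i ∈ t := by
    simp [t, Polynomial.mem_nthRoots hk, hf]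
  have h1 : d = ∑ y ∈ t, (Finset.univ.filter fun i => f i = y).card := by
    simpa using Finset.card_eq_sum_card_fiberwise (s := Finset.univ) (t := t) (f := f)
      (fun i _ => hmem i)
  have h2 : Fintype.card {p : Fin d × Fin d // f p.1 = f p.2} =
      ∑ y ∈ t, (Finset.univ.filter fun i => f i = y).card ^ 2 := by
    rw [Fintype.card_subtype, Finset.card_eq_sum_card_fiberwise (t := t) (f := fun p => f p.1)
      (fun p _ => hmem p.1)]
    refine Finset.sum_congr rfl fun y _ => ?_
    rw [sq, ← Finset.card_product]
    congr 1
    ext ⟨i, j⟩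
    simp only [Finset.mem_filter, Finset.mem_univ, true_and, Finset.mem_product]
    grind
  calc d ^ 2 ≤ t.card * Fintype.card {p : Fin d × Fin d // f p.1 = f p.2} := by
        rw [h2]; nth_rw 1 [h1]; exact sq_sum_le_card_mul_sum_sq
    _ ≤ _ := Nat.mul_le_mul_right _ ht

theorem sq_le_mul_finrank_commutantSubmodule {d k n : ℕ} (hk : 0 < k) (hn : 0 < n) (c : ℂ)
    (T : Matrix (Fin d) (Fin d) ℂ) (hT : T ^ n = 1) (hc : T ^ k = c • 1) :
    d ^ 2 ≤ k * finrank ℂ (commutantSubmodule T) := by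
  obtain ⟨P, f, h⟩ := exists_mul_eq_mul_diagonal_of_pow_eq_one hn T hT
  have hpow (m : ℕ) : T ^ m * P = P * diagonal f ^ m := by
    have : SemiconjBy (P : Matrix (Fin d) (Fin d) ℂ) (diagonal f) T := h.symm
    exact (this.pow_right m).eq.symm
  have hdiag : diagonal f ^ k = c • (1 : Matrix (Fin d) (Fin d) ℂ) := by
    rw [← Units.mul_right_inj P, ← hpow, hc]; simp
  refine (sq_le_mul_card_eq_pairs hk c f fun i => ?_).trans
    (Nat.mul_le_mul_left k (card_eq_pairs_le_finrank_commutantSubmodule T P f h))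
  simpa [diagonal_pow] using congrFun (congrFun hdiag i) i

/-- Schur's lemma for an irreducible pair of matrices. -/
theorem MatPairIrreducible.exists_eq_smul_one {d : ℕ} (hd : 0 < d)
    {A B X : Matrix (Fin d) (Fin d) ℂ} (hirr : MatPairIrreducible A B)
    (hA : A * X = X * A) (hB : B * X = X * B) : ∃ c : ℂ, X = c • 1 := by
  have : Nonempty (Fin d) := ⟨⟨0, hd⟩⟩
  obtain ⟨μ, hμ⟩ := End.exists_eigenvalue (toLin' X)
  have hmem (v : Fin d → ℂ) : v ∈ End.eigenspace (toLin' X) μ ↔ X *ᵥ v = μ • v := by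
    simp
  have hinv (C : Matrix (Fin d) (Fin d) ℂ) (hC : C * X = X * C) :
      ∀ v ∈ End.eigenspace (toLin' X) μ, C *ᵥ v ∈ End.eigenspace (toLin' X) μ := by
    intro v hv
    rw [hmem] at hv ⊢
    rw [mulVec_mulVec, ← hC, ← mulVec_mulVec, hv, mulVec_smul]
  rcases hirr _ (hinv A hA) (hinv B hB) with h | h
  · exact absurd h hμ
  · refine ⟨μ, toLin'.injective (LinearMap.ext fun v => ?_)⟩
    have hv : v ∈ End.eigenspace (toLin' X) μ := h ▸ Submodule.mem_top
    simpa using (hmem v).1 hv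

/-- Scott's inequality for the conjugation action on matrices: if only scalar matrices commute
with both `S = U * A` and `U`, then the dimensions of the commutants of `S`, `U` and `A` add up
to at most `d ^ 2 + 2`. -/
theorem finrank_commutantSubmodule_add_le {d : ℕ} (S U A : (Matrix (Fin d) (Fin d) ℂ)ˣ)
    (hS : S = U * A)
    (hschur : commutantSubmodule (S : Matrix (Fin d) (Fin d) ℂ) ⊓ commutantSubmodule U.val ≤
      Submodule.span ℂ {1}) :
    finrank ℂ (commutantSubmodule S.val) + finrank ℂ (commutantSubmodule U.val) +
      finrank ℂ (commutantSubmodule A.val) ≤ d ^ 2 + 2 := by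
  have hspan {W : Submodule ℂ (Matrix (Fin d) (Fin d) ℂ)} (hW : W ≤ Submodule.span ℂ {1}) :
      finrank ℂ W ≤ 1 :=
    (Submodule.finrank_mono hW).trans ((finrank_span_le_card _).trans (by simp))
  set W := commutantSubmodule S.val ⊔ commutantSubmodule U.val with hW
  have h1 := Submodule.finrank_sup_add_finrank_inf_eq
    (commutantSubmodule S.val) (commutantSubmodule U.val)
  rw [← hW] at h1
  have h2 := hspan hschur
  have h3 := Subspace.finrank_add_finrank_dualAnnihilator_eq W
  have h4 : finrank ℂ (Matrix (Fin d) (Fin d) ℂ) = d ^ 2 := by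
    simp [finrank_matrix, sq]
  let D : Matrix (Fin d) (Fin d) ℂ →ₗ[ℂ] Matrix (Fin d) (Fin d) ℂ :=
    LinearMap.mulLeft ℂ S.val ∘ₗ LinearMap.mulRight ℂ S⁻¹.val - LinearMap.id
  let φ : Matrix (Fin d) (Fin d) ℂ →ₗ[ℂ] Dual ℂ (Matrix (Fin d) (Fin d) ℂ) :=
    (LinearMap.compr₂ (LinearMap.mul ℂ _) (traceLinearMap (Fin d) ℂ ℂ)) ∘ₗ D
  have hφ (X Z) : φ X Z = trace ((S.val * (X * S⁻¹.val) - X) * Z) := rfl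
  have htr (T : (Matrix (Fin d) (Fin d) ℂ)ˣ) (X Z : Matrix (Fin d) (Fin d) ℂ)
      (hZ : T.val * Z = Z * T.val) : trace ((T.val * (X * T⁻¹.val) - X) * Z) = 0 := by
    have hZ' : T⁻¹.val * Z * T.val = Z := by rw [mul_assoc, ← hZ, Units.inv_mul_cancel_left]
    rw [sub_mul, trace_sub, sub_eq_zero, mul_assoc, trace_mul_comm, mul_assoc, mul_assoc,
      ← mul_assoc T⁻¹.val, hZ']
  have hconj (X) (hX : X ∈ commutantSubmodule A.val) :
      S.val * (X * S⁻¹.val) = U.val * (X * U⁻¹.val) := by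
    rw [mem_commutantSubmodule] at hX
    rw [hS, _root_.mul_inv_rev, Units.val_mul, Units.val_mul, mul_assoc, ← mul_assoc A.val,
      hX, mul_assoc X, Units.mul_inv_cancel_left]
  have hmaps (X : commutantSubmodule A.val) :
      (φ ∘ₗ (commutantSubmodule A.val).subtype) X ∈ W.dualAnnihilator := by
    rw [hW, Submodule.dualAnnihilator_sup_eq, Submodule.mem_inf,
      Submodule.mem_dualAnnihilator, Submodule.mem_dualAnnihilator]
    refine ⟨fun Z hZ => ?_, fun Z hZ => ?_⟩ <;>
      rw [LinearMap.comp_apply, Submodule.subtype_apply, hφ]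
    · exact htr S X Z (mem_commutantSubmodule.1 hZ)
    · rw [hconj X X.2]
      exact htr U X Z (mem_commutantSubmodule.1 hZ)
  let ψ := (φ ∘ₗ (commutantSubmodule A.val).subtype).codRestrict _ hmaps
  have h5 := LinearMap.finrank_range_add_finrank_ker ψ
  have h6 := Submodule.finrank_le (LinearMap.range ψ)
  have h7 : finrank ℂ (LinearMap.ker ψ) ≤ 1 := by
    rw [← Submodule.finrank_map_subtype_eq]
    refine hspan (le_trans ?_ hschur)
    rintro _ ⟨⟨X, hX⟩, hker, rfl⟩
    have hzero : φ X = 0 := congrArg Subtype.val hker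
    have h8 : S.val * (X * S⁻¹.val) = X := by
      rw [← sub_eq_zero, ext_iff_trace_mul_right]
      intro Z
      rw [← hφ, hzero]
      simp
    have h9 := hconj X hX
    rw [h8] at h9
    refine ⟨mem_commutantSubmodule.2 ?_, mem_commutantSubmodule.2 ?_⟩
    · rw [← mul_assoc] at h8
      exact (Units.mul_inv_eq_iff_eq_mul S).1 h8
    · rw [← mul_assoc] at h9
      exact (Units.mul_inv_eq_iff_eq_mul U).1 h9.symm
  omega

theorem stmt0 (d : ℕ) (hd2 : 2 ≤ d) (hd5 : d ≤ 5)
    (A B : Matrix (Fin d) (Fin d) ℂ) (hA : IsUnit A) (hB : IsUnit B)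
    (hbraid : A * B * A = B * A * B)
    (hirr : MatPairIrreducible A B)
    (hfin : Set.Finite (matGenGroup A B : Set (Matrix (Fin d) (Fin d) ℂ)ˣ)) :
    (∃ f : Fin d → ℂ, Function.Injective f ∧ ∀ i, f i ∈ spectrum ℂ A) ∧
      (∀ μ ∈ spectrum ℂ A, ∃ n : ℕ, 0 < n ∧ μ ^ n = 1) := by
  have hd : 0 < d := by omega
  obtain ⟨a, rfl⟩ := hA
  obtain ⟨b, rfl⟩ := hB
  have ha : a ∈ matGenGroup a.val b.val := Subgroup.subset_closure (Or.inl rfl)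
  have hb : b ∈ matGenGroup a.val b.val := Subgroup.subset_closure (Or.inr rfl)
  have horder (g) (hg : g ∈ matGenGroup a.val b.val) : ∃ n, 0 < n ∧ g.val ^ n = 1 := by
    have : Finite (matGenGroup a.val b.val) := hfin
    obtain ⟨n, hn, h⟩ := (isOfFinOrder_of_finite
      (⟨g, hg⟩ : matGenGroup a.val b.val)).exists_pow_eq_one
    refine ⟨n, hn, ?_⟩
    simpa using congrArg (fun x : matGenGroup a.val b.val => x.val.val) h
  have hab : a * b * a = b * a * b := Units.ext (by simpa using hbraid)
  obtain ⟨nA, hnA, hpA⟩ := horder a ha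
  obtain ⟨nU, hnU, hpU⟩ := horder (a * b) (mul_mem ha hb)
  obtain ⟨nS, hnS, hpS⟩ := horder (a * b * a) (mul_mem (mul_mem ha hb) ha)
  have hSa : (a * b * a) * a = b * (a * b * a) := by
    rw [hab]; simp only [mul_assoc] at hab ⊢; rw [hab]
  have hSb : (a * b * a) * b = a * (a * b * a) := by
    nth_rw 2 [hab]; simp only [mul_assoc]
  have hcube : (a * b) ^ 3 = (a * b * a) ^ 2 := by
    calc (a * b) ^ 3 = (a * b * a) * (b * a * b) := by
          simp only [pow_succ, pow_zero, one_mul, mul_assoc]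
      _ = (a * b * a) ^ 2 := by rw [← hab, sq]
  have hcenA : Commute a ((a * b * a) ^ 2) := by
    rw [sq]; exact (SemiconjBy.mul_left (y := b) hSb hSa).symm
  have hcenB : Commute b ((a * b * a) ^ 2) := by
    rw [sq]; exact (SemiconjBy.mul_left (y := a) hSa hSb).symm
  obtain ⟨c, hc⟩ := hirr.exists_eq_smul_one hd (X := ((a * b * a) ^ 2).val)
    (congrArg Units.val hcenA.eq) (congrArg Units.val hcenB.eq)
  have hS := sq_le_mul_finrank_commutantSubmodule two_pos hnS c _ hpS (by simpa using hc)
  have hU := sq_le_mul_finrank_commutantSubmodule three_pos hnU c _ hpU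
    (by rw [← hcube] at hc; simpa using hc)
  have hsum := finrank_commutantSubmodule_add_le (a * b * a) (a * b) a rfl (by
    rintro X ⟨hXS, hXU⟩
    rw [SetLike.mem_coe, mem_commutantSubmodule] at hXS hXU
    have hXa : a.val * X = X * a.val := by
      rw [← Units.mul_right_inj (a * b), ← mul_assoc, ← mul_assoc, hXU, mul_assoc X,
        ← Units.val_mul, hXS]
    have hXb : b.val * X = X * b.val := by
      rw [← Units.mul_right_inj a, ← mul_assoc, ← mul_assoc, hXa, mul_assoc X,
        ← Units.val_mul, hXU]
    obtain ⟨x, rfl⟩ := hirr.exists_eq_smul_one hd hXa hXb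
    exact Submodule.smul_mem _ _ (Submodule.mem_span_singleton_self _))
  obtain ⟨P, f, hP⟩ := exists_mul_eq_mul_diagonal_of_pow_eq_one hnA _ hpA
  have hcard : Fintype.card {p : Fin d × Fin d // f p.1 = f p.2} ≤ d := by
    refine (card_eq_pairs_le_finrank_commutantSubmodule _ P f hP).trans ?_
    interval_cases d <;> omega
  refine ⟨⟨f, fun i j hij => ?_, fun i => ?_⟩, fun μ hμ => ⟨nA, hnA, ?_⟩⟩
  · let δ : Fin d → {p : Fin d × Fin d // f p.1 = f p.2} := fun i => ⟨(i, i), rfl⟩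
    have hδ : Function.Injective δ := fun i j h => by simpa [δ] using h
    obtain ⟨k, hk⟩ := (hδ.bijective_of_nat_card_le (by simpa using hcard)).2 ⟨(i, j), hij⟩
    simp only [δ, Subtype.mk.injEq, Prod.mk.injEq] at hk
    exact hk.1.symm.trans hk.2
  · have hD : a.val = P * diagonal f * (P⁻¹ : (Matrix (Fin d) (Fin d) ℂ)ˣ) := by
      rw [← hP, Units.mul_inv_cancel_right]
    rw [hD, spectrum.units_conjugate, spectrum_diagonal]
    exact ⟨i, rfl⟩
  · have hpow := spectrum.pow_mem_pow a.val nA hμ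
    have : Nonempty (Fin d) := ⟨⟨0, hd⟩⟩
    rw [hpA] at hpow
    simpa [spectrum.one_eq] using hpow
end

section
/- Let p ≥ 2 be an integer. The quotient of the braid group B₃ by the normal subgroup generated by σ₁^p is finite if and only if p ≤ 5. Concretely: the presented group on two generators x, y with relations x*y*x*(y*x*y)⁻¹ = 1 and x^p = 1 is a finite group if and only if p ∈ {2, 3, 4, 5}. -/
/-- The relations for the quotient of the braid group `B₃ = ⟨x, y ∣ xyx = yxy⟩`
by the normal closure of `x^p`. -/
def braidQuotRels (p : ℕ) : Set (FreeGroup (Fin 2)) :=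
  { FreeGroup.of 0 * FreeGroup.of 1 * FreeGroup.of 0 *
      (FreeGroup.of 1 * FreeGroup.of 0 * FreeGroup.of 1)⁻¹,
    FreeGroup.of 0 ^ p }

open Pointwise in
/-- If `W` is a finite set containing `1` and `a` is an involution such that the union of the double
cosets of `⟨x⟩` meeting `W` is stable under left multiplication by `a`, then `⟨x, a⟩` is finite. -/
theorem finite_of_double_cosets {Q : Type*} [Group Q] {x a : Q} {p : ℕ} (hp : 0 < p)
    (hx : x ^ p = 1) (ha : a * a = 1) (hgen : Subgroup.closure {x, a} = ⊤)
    (W : Set Q) (hW : W.Finite) (h1 : 1 ∈ W)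
    (hstep : ∀ i < p, ∀ w ∈ W, ∃ m n : ℤ, ∃ v ∈ W, a * x ^ i * w = x ^ m * v * x ^ n) :
    Finite Q := by
  let H : Set Q := (Subgroup.zpowers x : Set Q)
  have hH : H.Finite := by
    have : IsOfFinOrder x := isOfFinOrder_iff_pow_eq_one.mpr ⟨p, hp, hx⟩
    exact this.finite_zpowers
  let S : Set Q := {g | ∃ m n : ℤ, ∃ v ∈ W, g = x ^ m * v * x ^ n}
  have hS : S.Finite := by
    refine ((hH.mul hW).mul hH).subset ?_
    rintro g ⟨m, n, v, hv, rfl⟩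
    exact Set.mul_mem_mul (Set.mul_mem_mul ⟨m, rfl⟩ hv) ⟨n, rfl⟩
  have hxS (k : ℤ) (g : Q) (hg : g ∈ S) : x ^ k * g ∈ S := by
    obtain ⟨m, n, v, hv, rfl⟩ := hg
    exact ⟨k + m, n, v, hv, by simp only [zpow_add, mul_assoc]⟩
  have haS (g : Q) (hg : g ∈ S) : a * g ∈ S := by
    obtain ⟨m, n, v, hv, rfl⟩ := hg
    have hmod : x ^ m = x ^ (m % p).toNat := by
      have h0 : (0 : ℤ) ≤ m % p := Int.emod_nonneg _ (by lia)
      rw [← zpow_natCast, Int.toNat_of_nonneg h0]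
      conv_lhs => rw [← Int.emod_add_mul_ediv m p, zpow_add, zpow_mul, zpow_natCast, hx,
        one_zpow, mul_one]
    have hlt : (m % p).toNat < p := by
      have := Int.emod_lt_of_pos m (b := (p : ℤ)) (by lia)
      lia
    obtain ⟨m', n', v', hv', h⟩ := hstep _ hlt v hv
    refine ⟨m', n' + n, v', hv', ?_⟩
    rw [hmod, zpow_add, ← mul_assoc, ← mul_assoc, h]
    simp only [mul_assoc]
  have hainv : a⁻¹ = a := inv_eq_of_mul_eq_one_left ha
  have huniv : S = Set.univ := by
    refine Set.eq_univ_of_forall fun g => ?_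
    have hg : g ∈ Subgroup.closure {x, a} := hgen ▸ Subgroup.mem_top g
    induction hg using Subgroup.closure_induction_left with
    | one => exact ⟨0, 0, 1, h1, by simp⟩
    | mul_left u hu y _ ih =>
      rcases hu with rfl | rfl
      · simpa using hxS 1 y ih
      · exact haS y ih
    | inv_mul_cancel u hu y _ ih =>
      rcases hu with rfl | rfl
      · simpa using hxS (-1) y ih
      · rw [hainv]
        exact haS y ih
  exact Set.finite_univ_iff.mp (huniv ▸ hS)

/-- The triangle group `(2, 3, p)` is finite for `2 ≤ p ≤ 5`. -/
theorem finite_triangle_group {Q : Type*} [Group Q] {x a : Q} {p : ℕ} (hp : 2 ≤ p) (hp5 : p ≤ 5)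
    (hx : x ^ p = 1) (ha : a * a = 1) (hax : a * x * a = x⁻¹ * a * x⁻¹)
    (hgen : Subgroup.closure {x, a} = ⊤) : Finite Q := by
  have ha' (g : Q) : a * (a * g) = g := by rw [← mul_assoc, ha, one_mul]
  have hax0 : a * (x * a) = x⁻¹ * (a * x⁻¹) := by simpa only [mul_assoc] using hax
  have hax' (g : Q) : a * (x * (a * g)) = x⁻¹ * (a * (x⁻¹ * g)) := by
    simpa only [mul_assoc] using congrArg (· * g) hax
  have haX0 : a * (x⁻¹ * a) = x * (a * x) := by
    have h := congrArg (·⁻¹) hax0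
    have hainv : a⁻¹ = a := inv_eq_of_mul_eq_one_left ha
    simpa only [mul_inv_rev, hainv, inv_inv, mul_assoc] using h
  have haX' (g : Q) : a * (x⁻¹ * (a * g)) = x * (a * (x * g)) := by
    simpa only [mul_assoc] using congrArg (· * g) haX0
  interval_cases p
  · refine finite_of_double_cosets (by norm_num) hx ha hgen {1, a} (by simp) (by simp) ?_
    intro i hi w hw
    rcases hw with rfl | rfl
    · exact ⟨0, i, a, by simp, by simp⟩
    · interval_cases i
      · exact ⟨0, 0, 1, by simp, by simp [ha]⟩
      · exact ⟨-1, -1, w, by simp, by simp [hax]⟩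
  · refine finite_of_double_cosets (by norm_num) hx ha hgen {1, a} (by simp) (by simp) ?_
    have h2 : x ^ 2 = x⁻¹ := eq_inv_of_mul_eq_one_left (by rw [← pow_succ, hx])
    intro i hi w hw
    rcases hw with rfl | rfl
    · exact ⟨0, i, a, by simp, by simp⟩
    · interval_cases i
      · exact ⟨0, 0, 1, by simp, by simp [ha]⟩
      · exact ⟨-1, -1, w, by simp, by simp [hax]⟩
      · exact ⟨1, 1, w, by simp, by simp [h2, haX0, mul_assoc]⟩
  · refine finite_of_double_cosets (by norm_num) hx ha hgen {1, a, a * x ^ 2 * a} (by simp)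
      (by simp) ?_
    have hx4 (g : Q) : x * (x * (x * (x * g))) = g := by
      simpa [pow_succ, mul_assoc] using congrArg (· * g) hx
    have h2 (g : Q) : x⁻¹ * (x⁻¹ * g) = x * (x * g) := by
      rw [inv_mul_eq_iff_eq_mul, inv_mul_eq_iff_eq_mul, hx4]
    have h2' : x⁻¹ * x⁻¹ = x * x := by simpa using h2 1
    have h3 : x ^ 3 = x⁻¹ := eq_inv_of_mul_eq_one_left (by rw [← pow_succ, hx])
    intro i hi w hw
    rcases hw with rfl | rfl | rfl
    · exact ⟨0, i, a, by simp, by simp⟩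
    · interval_cases i
      · exact ⟨0, 0, 1, by simp, by simp [ha]⟩
      · exact ⟨-1, -1, w, by simp, by simp [hax]⟩
      · exact ⟨0, 0, w * x ^ 2 * w, by simp, by simp⟩
      · exact ⟨1, 1, w, by simp, by simp [h3, haX0, mul_assoc]⟩
    · interval_cases i
      · exact ⟨2, 0, a, by simp, by simp [mul_assoc, ha', zpow_ofNat]⟩
      · refine ⟨-2, -1, a, by simp, ?_⟩
        simp [mul_assoc, hax', hax0, zpow_neg, zpow_ofNat, pow_two]
      · refine ⟨2, 2, a, by simp, ?_⟩
        calc a * x ^ 2 * (a * x ^ 2 * a) = a * (x * (x * (a * (x * (x * a))))) := by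
              simp only [pow_two, mul_assoc]
          _ = x ^ 2 * a * x ^ 2 := by
              rw [← haX', hax0, hax', h2, mul_inv_cancel_left, hax', h2, h2']
              simp only [pow_two, mul_assoc]
          _ = _ := by simp only [zpow_ofNat]
      · refine ⟨2, 1, a, by simp, ?_⟩
        rw [h3, mul_assoc, mul_assoc, mul_assoc, haX', pow_two, mul_assoc, ← h2,
          inv_mul_cancel_left, haX0]
        simp only [zpow_ofNat, pow_two, pow_one, mul_assoc]
  · let b := a * x ^ 2 * a
    let u := a * x ^ 3 * b
    have hx5 (g : Q) : x * (x * (x * (x * (x * g)))) = g := by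
      simpa [pow_succ, mul_assoc] using congrArg (· * g) hx
    have h4 : x ^ 4 = x⁻¹ := eq_inv_of_mul_eq_one_left (by rw [← pow_succ, hx])
    have h3 (g : Q) : x⁻¹ * (x⁻¹ * g) = x * (x * (x * g)) := by
      rw [inv_mul_eq_iff_eq_mul, inv_mul_eq_iff_eq_mul, hx5]
    have hab : a * b = x ^ 2 * a := by simp only [b, mul_assoc, ha']
    have haXX : a * x ^ 3 * a = x * b * x := by
      simp only [b, pow_succ, pow_zero, one_mul, mul_assoc]
      rw [← h3, ← haX' (x * (a * x)), hax', inv_mul_cancel, mul_one]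
    have hab1 : a * x * b = x⁻¹ * x⁻¹ * a * x⁻¹ := by
      simp only [b, pow_two, mul_assoc]
      rw [hax', inv_mul_cancel_left, hax0]
    have hab2 : a * x ^ 2 * b = x⁻¹ * b * x⁻¹ := by
      simp only [b, pow_two, mul_assoc]
      rw [← haX', hax0, hax', h3, mul_inv_cancel_left]
    have hab4 : a * x ^ 4 * b = x * x * b * x := by
      rw [mul_assoc x x, mul_assoc x, ← haXX, h4]
      simp only [b, pow_succ, pow_zero, one_mul, mul_assoc, haX']
    have hxu : x * u = u * x⁻¹ := by
      rw [eq_mul_inv_iff_mul_eq]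
      calc x * u * x = x * a * x ^ 2 * (x * b * x) := by
            simp only [u, pow_succ, pow_zero, one_mul, mul_assoc]
        _ = x * b * x * (x ^ 2 * a) := by
            nth_rw 1 [← haXX]
            simp only [b, pow_succ, pow_zero, one_mul, mul_assoc]
        _ = u := by
            rw [← haXX]
            simp only [u, b, mul_assoc]
    have hau (i : ℕ) : a * x ^ i * u = x ^ 3 * b * x⁻¹ ^ i := by
      have h : SemiconjBy u x⁻¹ x := hxu.symm
      rw [mul_assoc, ← (h.pow_right i).eq]
      simp only [u, mul_assoc, ha']
    refine finite_of_double_cosets (by norm_num) hx ha hgen {1, a, b, u} (by simp) (by simp) ?_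
    intro i hi w hw
    rcases hw with rfl | rfl | rfl | rfl
    · exact ⟨0, i, a, by simp, by simp⟩
    · interval_cases i
      · exact ⟨0, 0, 1, by simp, by simp [ha]⟩
      · exact ⟨-1, -1, w, by simp, by simp [hax]⟩
      · exact ⟨0, 0, b, by simp, by simp [b]⟩
      · exact ⟨1, 1, b, by simp, by simp [haXX]⟩
      · exact ⟨1, 1, w, by simp, by simp [h4, haX0, mul_assoc]⟩
    · interval_cases i
      · exact ⟨2, 0, a, by simp, by simp [hab, zpow_ofNat]⟩
      · exact ⟨-2, -1, a, by simp, by simp [hab1, zpow_neg, zpow_ofNat, pow_two]⟩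
      · exact ⟨-1, -1, b, by simp, by simp [hab2]⟩
      · exact ⟨0, 0, u, by simp, by simp [u]⟩
      · exact ⟨2, 1, b, by simp, by simp [hab4, zpow_ofNat, pow_two]⟩
    · exact ⟨3, -i, b, by simp, by simp [hau, zpow_ofNat]⟩

/-- A group generated by two braiding elements of order dividing `p ≤ 5` is finite. -/
theorem finite_of_braid {G : Type*} [Group G] {x y : G} {p : ℕ} (hp : 2 ≤ p) (hp5 : p ≤ 5)
    (hxy : x * y * x = y * x * y) (hx : x ^ p = 1)
    (hgen : Subgroup.closure {x, y} = ⊤) : Finite G := by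
  obtain ⟨d, hd⟩ : ∃ d, d = x * y * x := ⟨_, rfl⟩
  have hdx : d * x = y * d := by nth_rw 1 [hd, hxy]; simp only [hd, mul_assoc]
  have hdy : d * y = x * d := by rw [hd, mul_assoc x, mul_assoc x, ← hxy]; simp only [mul_assoc]
  have hy : y ^ p = 1 := by
    have h : y = d * x * d⁻¹ := by rw [hdx, mul_inv_cancel_right]
    rw [h, conj_pow, hx, mul_one, mul_inv_cancel]
  have hz : d * d ∈ Subgroup.center G := by
    have hle : Subgroup.closure {x, y} ≤ Subgroup.centralizer {d * d} := by
      rw [Subgroup.closure_le]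
      rintro g (rfl | rfl) <;> rw [SetLike.mem_coe, Subgroup.mem_centralizer_singleton_iff]
      · rw [mul_assoc d, hdx, ← mul_assoc d, hdy, mul_assoc]
      · rw [mul_assoc d, hdy, ← mul_assoc d, hdx, mul_assoc]
    rw [Subgroup.mem_center_iff]
    intro g
    have hg : g ∈ Subgroup.centralizer {d * d} := hle (hgen ▸ Subgroup.mem_top g)
    exact (Subgroup.mem_centralizer_singleton_iff.mp hg)
  let Z := Subgroup.zpowers (d * d)
  have hZ : Z ≤ Subgroup.center G := by simpa [Z] using hz
  have : Z.Normal :=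
    ⟨fun n hn g => by rwa [Subgroup.mem_center_iff.mp (hZ hn) g, mul_inv_cancel_right]⟩
  have hQ : Finite (G ⧸ Z) := by
    let π := QuotientGroup.mk' Z
    have hπ : Function.Surjective π := QuotientGroup.mk'_surjective Z
    have hdd : π d * π d = 1 := by
      rw [← map_mul]
      exact (QuotientGroup.eq_one_iff _).mpr (Subgroup.mem_zpowers _)
    refine finite_triangle_group (x := π x) (a := π d) hp hp5 (by rw [← map_pow, hx, map_one])
      hdd ?_ ?_
    · have h1 : x⁻¹ * d * x⁻¹ = y := by rw [hd]; group
      have h2 : d * x * d = y * (d * d) := by rw [hdx, mul_assoc]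
      simp only [← map_mul, ← map_inv]
      rw [h1, h2, map_mul, map_mul, hdd, mul_one]
    · have h : Subgroup.closure {x, d} = ⊤ := by
        rw [eq_top_iff, ← hgen, Subgroup.closure_le]
        have hxm : x ∈ Subgroup.closure {x, d} := Subgroup.subset_closure (by simp)
        have hdm : d ∈ Subgroup.closure {x, d} := Subgroup.subset_closure (by simp)
        rintro g (rfl | rfl)
        · exact hxm
        · have h : g = x⁻¹ * d * x⁻¹ := by rw [hd]; group
          rw [h]
          exact mul_mem (mul_mem (inv_mem hxm) hdm) (inv_mem hxm)
      have := congrArg (Subgroup.map π) h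
      rwa [MonoidHom.map_closure, Set.image_pair, Subgroup.map_top_of_surjective π hπ] at this
  have : Z.FiniteIndex := Subgroup.finiteIndex_of_finite_quotient
  have : (Subgroup.center G).FiniteIndex := Subgroup.finiteIndex_of_le hZ
  have hfin : IsOfFinOrder (d * d) := by
    let τ := MonoidHom.transferCenterPow G
    have hmul (u v : Subgroup.center G) : (u * v) ^ p = u ^ p * v ^ p :=
      Commute.mul_pow (Subtype.ext (Subgroup.mem_center_iff.mp v.2 u)) p
    have hτ : (τ (d * d)) ^ p = 1 := by
      have hτx : τ x ^ p = 1 := by rw [← map_pow, hx, map_one]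
      have hτy : τ y ^ p = 1 := by rw [← map_pow, hy, map_one]
      rw [hd, map_mul, map_mul, map_mul]
      simp only [hmul, hτx, hτy, mul_one]
    refine isOfFinOrder_iff_pow_eq_one.mpr ⟨(Subgroup.center G).index * p,
      Nat.mul_pos (Nat.pos_of_ne_zero Subgroup.FiniteIndex.index_ne_zero) (by lia), ?_⟩
    have := congrArg (Subtype.val) hτ
    rw [pow_mul, ← MonoidHom.transferCenterPow_apply]
    exact this
  have : Finite Z := hfin.finite_zpowers.to_subtype
  exact Finite.of_equiv _ (Subgroup.groupEquivQuotientProdSubgroup (s := Z)).symm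

/-- A `2 × 2` matrix with determinant `1`, real trace at least `2` and nonzero lower left entry
has infinite order. -/
theorem pow_ne_one_of_two_le_trace {M : Matrix (Fin 2) (Fin 2) ℂ} (hdet : M.det = 1) {t : ℝ}
    (ht : 2 ≤ t) (htr : M.trace = t) (h10 : M 1 0 ≠ 0) {n : ℕ} (hn : 0 < n) : M ^ n ≠ 1 := by
  have hsq : M * M = (t : ℂ) • M - 1 := by
    rw [← htr]
    rw [Matrix.det_fin_two] at hdet
    ext i j
    fin_cases i <;> fin_cases j <;>
      simp [Matrix.mul_apply, Fin.sum_univ_two, Matrix.trace_fin_two] <;>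
      first | ring1 | linear_combination -hdet
  have key (k : ℕ) : ∃ a b : ℝ, 0 ≤ a ∧ a < b ∧ M ^ (k + 1) = (b : ℂ) • M - (a : ℂ) • 1 := by
    induction k with
    | zero => exact ⟨0, 1, le_rfl, one_pos, by simp⟩
    | succ k ih =>
      obtain ⟨a, b, ha, hab, h⟩ := ih
      refine ⟨b, t * b - a, by linarith, by nlinarith, ?_⟩
      rw [pow_succ, h, sub_mul, smul_mul_assoc, hsq, smul_mul_assoc, one_mul]
      push_cast
      module
  obtain ⟨k, rfl⟩ := Nat.exists_eq_add_of_lt hn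
  obtain ⟨a, b, ha, hab, h⟩ := key k
  intro h1
  rw [zero_add] at h1
  have h2 := congrFun (congrFun (h.symm.trans h1) 1) 0
  have hb : (b : ℂ) ≠ 0 := by exact_mod_cast (by linarith : b ≠ 0)
  simp [h10, hb] at h2

/-- For `p ≥ 6` the reduced Burau representation at a primitive `p`-th root of unity has infinite
image. -/
theorem infinite_braid_quotient {p : ℕ} (hp : 6 ≤ p) :
    Infinite (PresentedGroup (braidQuotRels p)) := by
  have hp0 : p ≠ 0 := by lia
  set ζ : ℂ := Complex.exp (2 * Real.pi * Complex.I / p) with hζdef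
  have hζ : IsPrimitiveRoot ζ p := Complex.isPrimitiveRoot_exp p hp0
  have hζ0 : ζ ≠ 0 := hζ.ne_zero hp0
  have hζ1 : ζ - 1 ≠ 0 := sub_ne_zero.mpr (hζ.ne_one (by lia))
  have htr : 1 + ζ + ζ⁻¹ = ((1 + 2 * Real.cos (2 * Real.pi / p) : ℝ) : ℂ) := by
    push_cast
    rw [Complex.two_cos, hζdef, ← Complex.exp_neg, add_assoc]
    congr 3 <;> ring
  have hcos : 2 ≤ 1 + 2 * Real.cos (2 * Real.pi / p) := by
    have h6 : (6 : ℝ) ≤ p := by exact_mod_cast hp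
    have hle : 2 * Real.pi / p ≤ Real.pi / 3 := by
      rw [div_le_div_iff₀ (by linarith) (by norm_num)]
      nlinarith [Real.pi_pos]
    have h := Real.cos_le_cos_of_nonneg_of_le_pi (by positivity) (by linarith [Real.pi_pos]) hle
    rw [Real.cos_pi_div_three] at h
    linarith
  let A : (Matrix (Fin 2) (Fin 2) ℂ)ˣ :=
    ⟨!![ζ, 1; 0, 1], !![ζ⁻¹, -ζ⁻¹; 0, 1],
      by simp [Matrix.one_fin_two, hζ0], by simp [Matrix.one_fin_two, hζ0]⟩
  let B : (Matrix (Fin 2) (Fin 2) ℂ)ˣ :=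
    ⟨!![1, 0; -ζ, ζ], !![1, 0; 1, ζ⁻¹],
      by simp [Matrix.one_fin_two, hζ0], by simp [Matrix.one_fin_two, hζ0]⟩
  have hAB : A * B * A = B * A * B := by
    ext1
    simp [A, B]
  have hApow (k : ℕ) : (A : Matrix (Fin 2) (Fin 2) ℂ) ^ k =
      !![ζ ^ k, (ζ ^ k - 1) / (ζ - 1); 0, 1] := by
    induction k with
    | zero => simp [Matrix.one_fin_two]
    | succ k ih =>
      have h : ζ ^ k + (ζ ^ k - 1) / (ζ - 1) = (ζ ^ (k + 1) - 1) / (ζ - 1) := by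
        field_simp
        ring
      rw [pow_succ, ih]
      simp [A, h, pow_succ]
  have hAp : A ^ p = 1 := by
    ext1
    rw [Units.val_pow_eq_pow_val, hApow, hζ.pow_eq_one]
    simp [Matrix.one_fin_two]
  have hrel : ∀ r ∈ braidQuotRels p, FreeGroup.lift ![A, B] r = 1 := by
    rintro r (rfl | rfl)
    · simp [hAB]
    · simp [hAp]
  let φ := PresentedGroup.toGroup hrel
  have hφ : ((φ (PresentedGroup.of 0 * (PresentedGroup.of 1)⁻¹) :) : Matrix (Fin 2) (Fin 2) ℂ) =
      !![1 + ζ, ζ⁻¹; 1, ζ⁻¹] := by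
    simp [φ, A, B, add_comm]
  by_contra hfin
  rw [not_infinite_iff_finite] at hfin
  obtain ⟨n, hn, h1⟩ := isOfFinOrder_iff_pow_eq_one.mp (isOfFinOrder_of_finite
    (PresentedGroup.of 0 * (PresentedGroup.of 1)⁻¹ : PresentedGroup (braidQuotRels p)))
  refine pow_ne_one_of_two_le_trace (M := !![1 + ζ, ζ⁻¹; 1, ζ⁻¹]) ?_ hcos ?_ (by simp) hn ?_
  · rw [Matrix.det_fin_two_of]
    field_simp
    ring
  · rw [Matrix.trace_fin_two_of, htr]
  · rw [← hφ, ← Units.val_pow_eq_pow_val, ← map_pow, h1, map_one, Units.val_one]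

theorem stmt1 (p : ℕ) (hp : 2 ≤ p) :
    Finite (PresentedGroup (braidQuotRels p)) ↔ p ≤ 5 := by
  constructor
  · intro h
    by_contra! hlt
    exact (infinite_braid_quotient hlt).not_finite h
  · intro hp5
    refine finite_of_braid (x := PresentedGroup.of 0) (y := PresentedGroup.of 1) hp hp5 ?_ ?_ ?_
    · exact mul_inv_eq_one.mp (PresentedGroup.one_of_mem (rels := braidQuotRels p)
        (Set.mem_insert _ _))
    · exact PresentedGroup.one_of_mem (rels := braidQuotRels p) (Set.mem_insert_of_mem _ rfl)
    · rw [← PresentedGroup.closure_range_of (braidQuotRels p)]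
      congr 1
      ext g
      simp [Set.mem_range, Fin.exists_fin_two, eq_comm]
end

section
/- Let d ≥ 1 and let A, B be invertible d×d complex matrices satisfying the braid relation A*B*A = B*A*B. Suppose there exist an integer p ∈ {2, 3, 4, 5} and a root of unity c ∈ ℂ such that A^p = c • (identity matrix). Then the subgroup of GL(d,ℂ) generated by A and B is finite. -/
section FiniteGeneration

open scoped commutatorElement

variable {G : Type*} [Group G]

/-- If `⟨a⟩` is finite and the finite union of double cosets `⟨a⟩ w ⟨a⟩`, `w ∈ W`, contains `1` and
is stable under right multiplication by the involution `x`, then a group generated by `a` and `x`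
is finite. -/
lemma finite_of_doubleCosets {a x : G} {p : ℕ} (hp : 0 < p) (ha : a ^ p = 1) (hx : x * x = 1)
    (hgen : Subgroup.closure {a, x} = ⊤) {W : Set G} (hW : W.Finite) (h1 : (1 : G) ∈ W)
    (hstep : ∀ w ∈ W, ∀ j < p, ∃ i k : ℤ, ∃ w' ∈ W, w * a ^ j * x = a ^ i * w' * a ^ k) :
    Finite G := by
  have hfin : IsOfFinOrder a := isOfFinOrder_iff_pow_eq_one.mpr ⟨p, hp, ha⟩
  have hZ : (Subgroup.zpowers a : Set G).Finite := by
    rwa [finite_zpowers]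
  let S : Set G := {g | ∃ i k : ℤ, ∃ w ∈ W, g = a ^ i * w * a ^ k}
  have hS : S.Finite := by
    refine ((hZ.mul hW).mul hZ).subset ?_
    rintro g ⟨i, k, w, hw, rfl⟩
    exact Set.mul_mem_mul (Set.mul_mem_mul ⟨i, rfl⟩ hw) ⟨k, rfl⟩
  have hxS : ∀ g ∈ S, g * x ∈ S := by
    rintro g ⟨i, k, w, hw, rfl⟩
    have hk : a ^ k = a ^ (k % p).toNat := by
      have hp' : (p : ℤ) ≠ 0 := by exact_mod_cast hp.ne'
      rw [← zpow_natCast, Int.toNat_of_nonneg (Int.emod_nonneg _ hp')]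
      conv_lhs => rw [← Int.emod_add_mul_ediv k p]
      rw [zpow_add, zpow_mul, zpow_natCast, ha, one_zpow, mul_one]
    have hlt : (k % p).toNat < p := by
      have hp' : (0 : ℤ) < p := by exact_mod_cast hp
      have := Int.emod_lt_of_pos k hp'
      omega
    obtain ⟨i', k', w', hw', h⟩ := hstep w hw _ hlt
    refine ⟨i + i', k', w', hw', ?_⟩
    rw [hk, mul_assoc, mul_assoc, ← mul_assoc w, h, zpow_add]
    simp only [mul_assoc]
  have hxi : x⁻¹ = x := inv_eq_of_mul_eq_one_left hx
  have hmem : ∀ g : G, g ∈ S := by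
    intro g
    have hg : g ∈ Subgroup.closure ({a, x} : Set G) := hgen ▸ Subgroup.mem_top g
    induction hg using Subgroup.closure_induction_right with
    | one => exact ⟨0, 0, 1, h1, by simp⟩
    | mul_right g _ y hy ih =>
      rcases hy with rfl | rfl
      · obtain ⟨i, k, w, hw, rfl⟩ := ih
        exact ⟨i, k + 1, w, hw, by rw [zpow_add_one, mul_assoc _ _ y]⟩
      · exact hxS _ ih
    | mul_inv_cancel g _ y hy ih =>
      rcases hy with rfl | rfl
      · obtain ⟨i, k, w, hw, rfl⟩ := ih
        exact ⟨i, k - 1, w, hw, by rw [zpow_sub_one, mul_assoc _ _ y⁻¹]⟩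
      · rw [hxi]
        exact hxS _ ih
  exact Set.finite_univ_iff.mp (hS.subset fun g _ => hmem g)

/-- The triangle groups `(2, 3, p)` with `2 ≤ p ≤ 5` are finite. -/
lemma finite_of_triangle_relations {a x : G} {p : ℕ} (hp : p ∈ ({2, 3, 4, 5} : Set ℕ))
    (ha : a ^ p = 1) (hx : x * x = 1) (hax : x * a * x = a⁻¹ * x * a⁻¹)
    (hgen : Subgroup.closure {a, x} = ⊤) : Finite G := by
  have hxx : ∀ g, x * (x * g) = g := fun g => by rw [← mul_assoc, hx, one_mul]
  have hxi : x⁻¹ = x := inv_eq_of_mul_eq_one_left hx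
  have hxax : ∀ g, x * (a * (x * g)) = a⁻¹ * (x * (a⁻¹ * g)) := fun g => by
    simpa only [mul_assoc] using congrArg (· * g) hax
  have hxbx : ∀ g, x * (a⁻¹ * (x * g)) = a * (x * (a * g)) := fun g => by
    simpa only [mul_assoc, mul_inv_rev, hxi, inv_inv] using congrArg (·⁻¹ * g) hax
  have hxax' : x * (a * x) = a⁻¹ * (x * a⁻¹) := by simpa using hxax 1
  have hxbx' : x * (a⁻¹ * x) = a * (x * a) := by simpa using hxbx 1
  have hxa2x : ∀ g, x * (a * (a * (x * g))) = a⁻¹ * (x * (a⁻¹ * (a⁻¹ * (x * (a⁻¹ * g))))) :=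
    fun g => by rw [← hxax, ← hxax, hxx]
  have hxb2x : ∀ g, x * (a⁻¹ * (a⁻¹ * (x * g))) = a * (x * (a * (a * (x * (a * g))))) :=
    fun g => by rw [← hxbx, ← hxbx, hxx]
  have hxa2x' : x * (a * (a * x)) = a⁻¹ * (x * (a⁻¹ * (a⁻¹ * (x * a⁻¹)))) := by
    simpa only [mul_one] using hxa2x 1
  have hxb2x' : x * (a⁻¹ * (a⁻¹ * x)) = a * (x * (a * (a * (x * a)))) := by
    simpa only [mul_one] using hxb2x 1
  rcases hp with rfl | rfl | rfl | rfl
  · refine finite_of_doubleCosets (by norm_num) ha hx hgen (W := {1, x}) (by simp) (by simp) ?_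
    rintro w (rfl | rfl) j hj
    · exact ⟨j, 0, x, by simp, by simp⟩
    · interval_cases j
      · exact ⟨0, 0, 1, by simp, by simp [hx]⟩
      · exact ⟨-1, -1, w, by simp, by simpa using hax⟩
  · have h2 : a ^ 2 = a⁻¹ := eq_inv_of_mul_eq_one_left (by rw [← pow_succ, ha])
    refine finite_of_doubleCosets (by norm_num) ha hx hgen (W := {1, x}) (by simp) (by simp) ?_
    rintro w (rfl | rfl) j hj
    · exact ⟨j, 0, x, by simp, by simp⟩
    · interval_cases j
      · exact ⟨0, 0, 1, by simp, by simp [hx]⟩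
      · exact ⟨-1, -1, w, by simp, by simpa using hax⟩
      · exact ⟨1, 1, w, by simp, by simp [h2, mul_assoc, hxbx']⟩
  · have h3 : a ^ 3 = a⁻¹ := eq_inv_of_mul_eq_one_left (by rw [← pow_succ, ha])
    have h4 : ∀ g, a * (a * (a * g)) = a⁻¹ * g := fun g => by
      rw [← h3]; simp only [pow_succ, pow_zero, one_mul, mul_assoc]
    have h5 : ∀ g, a⁻¹ * (a⁻¹ * (a⁻¹ * g)) = a * g := fun g => by
      rw [inv_mul_eq_iff_eq_mul, inv_mul_eq_iff_eq_mul, inv_mul_eq_iff_eq_mul, h4,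
        inv_mul_cancel_left]
    refine finite_of_doubleCosets (by norm_num) ha hx hgen (W := {1, x, x * a ^ 2 * x})
      (by simp) (by simp) ?_
    rintro w (rfl | rfl | rfl) j hj
    · exact ⟨j, 0, x, by simp, by simp⟩
    · interval_cases j
      · exact ⟨0, 0, 1, by simp, by simp [hx]⟩
      · exact ⟨-1, -1, w, by simp, by simpa using hax⟩
      · exact ⟨0, 0, w * a ^ 2 * w, by simp, by simp⟩
      · exact ⟨1, 1, w, by simp, by simp [h3, mul_assoc, hxbx']⟩
    · interval_cases j
      · exact ⟨0, 2, x, by simp, by simp [mul_assoc, hx]⟩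
      · exact ⟨-1, -2, x, by simp, by simp [pow_two, mul_assoc, hxax', hxax, zpow_neg]⟩
      · refine ⟨-2, -2, x, by simp, ?_⟩
        simp [pow_two, mul_assoc, hxa2x', hxax', hxax, h5, zpow_neg]
      · exact ⟨1, 2, x, by simp, by simp [h3, mul_assoc, hxbx', pow_two, h4, hxbx]⟩
  · have h4 : a ^ 4 = a⁻¹ := eq_inv_of_mul_eq_one_left (by rw [← pow_succ, ha])
    have h3 : a ^ 3 = a⁻¹ * a⁻¹ := by rw [← h4, ← pow_add, pow_eq_pow_mod 8 ha]
    have h5 : ∀ g, a * (a * (a * g)) = a⁻¹ * (a⁻¹ * g) := fun g => by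
      rw [← mul_assoc a⁻¹, ← h3]; simp only [pow_succ, pow_zero, one_mul, mul_assoc]
    have h6 : ∀ g, a⁻¹ * (a⁻¹ * (a⁻¹ * g)) = a * (a * g) := fun g => by
      rw [inv_mul_eq_iff_eq_mul, inv_mul_eq_iff_eq_mul, inv_mul_eq_iff_eq_mul, h5,
        inv_mul_cancel_left, inv_mul_cancel_left]
    set u := x * a ^ 2 * x * a ^ 3 * x with hu
    have hu_a : a * u * a = u := by
      have h_eq : u = a * (x * (a * (a * (x * (a⁻¹ * (a⁻¹ * (x * a))))))) := by
        rw [hu, h3]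
        simp only [pow_two, mul_assoc]
        rw [hxb2x', h5, hxb2x, h5]
      conv_rhs => rw [h_eq]
      simp only [hu, h3, pow_two, mul_assoc]
    refine finite_of_doubleCosets (by norm_num) ha hx hgen (W := {1, x, x * a ^ 2 * x, u})
      (by simp) (by simp) ?_
    rintro w (rfl | rfl | rfl | rfl) j hj
    · exact ⟨j, 0, x, by simp, by simp⟩
    · interval_cases j
      · exact ⟨0, 0, 1, by simp, by simp [hx]⟩
      · exact ⟨-1, -1, w, by simp, by simpa using hax⟩
      · exact ⟨0, 0, w * a ^ 2 * w, by simp, by simp⟩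
      · refine ⟨1, 1, w * a ^ 2 * w, by simp, ?_⟩
        simp [h3, mul_assoc, hxb2x', pow_two]
      · exact ⟨1, 1, w, by simp, by simp [h4, mul_assoc, hxbx']⟩
    · interval_cases j
      · exact ⟨0, 2, x, by simp, by simp [mul_assoc, hx]⟩
      · exact ⟨-1, -2, x, by simp, by simp [pow_two, mul_assoc, hxax', hxax, zpow_neg]⟩
      · refine ⟨-1, -1, x * a ^ 2 * x, by simp, ?_⟩
        simp [pow_two, mul_assoc, hxa2x', hxax', h6, hxa2x, zpow_neg]
      · exact ⟨0, 0, u, by simp, by simp [hu]⟩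
      · refine ⟨1, 2, x * a ^ 2 * x, by simp, ?_⟩
        simp [h4, mul_assoc, hxbx', pow_two, h5, hxb2x]
    · refine ⟨-j, -2, x * a ^ 2 * x, by simp, ?_⟩
      have hj' : u * a ^ j = (a ^ j)⁻¹ * u := by
        have : SemiconjBy u a a⁻¹ := by
          rw [SemiconjBy, eq_inv_mul_iff_mul_eq, ← mul_assoc, hu_a]
        rw [← inv_pow]
        exact this.pow_right j
      rw [hj']
      simp [hu, mul_assoc, hx, h3, pow_two, zpow_neg]

/-- A group with centre of finite index that is generated by two conjugate elements of finite order
is finite. -/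
lemma finite_of_finite_quotient_center {a b g : G} (ha : IsOfFinOrder a) (hab : g * a = b * g)
    (hgen : Subgroup.closure {a, b} = ⊤) [Finite (G ⧸ Subgroup.center G)] : Finite G := by
  have hcomm : (commutatorSet G).Finite := by
    refine (Set.finite_range fun q : (G ⧸ Subgroup.center G) × (G ⧸ Subgroup.center G) =>
      ⁅q.1.out, q.2.out⁆).subset ?_
    rintro _ ⟨x, y, rfl⟩
    refine ⟨(x, y), ?_⟩
    obtain ⟨z, hz⟩ := QuotientGroup.mk_out_eq_mul (Subgroup.center G) x
    obtain ⟨t, ht⟩ := QuotientGroup.mk_out_eq_mul (Subgroup.center G) y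
    have hzc := Subgroup.mem_center_iff.mp z.2
    have htc := Subgroup.mem_center_iff.mp t.2
    have h1 : x * z * (y * t) = x * y * (z * t) := by
      rw [mul_assoc, ← mul_assoc (z : G), ← hzc]; simp only [mul_assoc]
    have h2 : y * t * (x * z) = y * x * (z * t) := by
      rw [mul_assoc, ← mul_assoc (t : G), ← htc, htc z]; simp only [mul_assoc]
    calc ⁅(x : G ⧸ Subgroup.center G).out, (y : G ⧸ Subgroup.center G).out⁆
        = x * z * (y * t) * (y * t * (x * z))⁻¹ := by
          rw [hz, ht, commutatorElement_def]; group
      _ = ⁅x, y⁆ := by rw [h1, h2, commutatorElement_def]; group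
  have : Finite (commutatorSet G) := hcomm
  have hfin : IsOfFinOrder (QuotientGroup.mk' (commutator G) a) :=
    MonoidHom.isOfFinOrder _ ha
  have : Finite (G ⧸ commutator G) := by
    have htop : Subgroup.zpowers (QuotientGroup.mk' (commutator G) a) = ⊤ := by
      rw [eq_top_iff, ← Subgroup.map_top_of_surjective _ (QuotientGroup.mk'_surjective _), ← hgen,
        MonoidHom.map_closure, Subgroup.closure_le]
      rintro _ ⟨y, hy | hy, rfl⟩
      · exact hy ▸ Subgroup.mem_zpowers _
      · have hb : b = g * a * g⁻¹ := by rw [hab, mul_inv_cancel_right]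
        have hcom : ⁅g, a⁆ ∈ commutator G := by
          rw [commutator_eq_closure]
          exact Subgroup.subset_closure ⟨g, a, rfl⟩
        have : QuotientGroup.mk' (commutator G) b = QuotientGroup.mk' (commutator G) a := by
          have h1 : b = ⁅g, a⁆ * a := by rw [hb, commutatorElement_def, inv_mul_cancel_right]
          rw [h1, map_mul, QuotientGroup.mk'_apply, (QuotientGroup.eq_one_iff _).mpr hcom, one_mul]
        exact hy ▸ this ▸ Subgroup.mem_zpowers _
    rw [← finite_zpowers, htop] at hfin
    exact Set.finite_univ_iff.mp hfin
  exact Finite.of_subgroup_quotient (commutator G)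

/-- A quotient of the braid group on three strands in which a standard generator has finite order
and its `p`-th power is central, `2 ≤ p ≤ 5`, is finite. -/
lemma finite_of_braid_s2 {a b : G} {p : ℕ} (hp : p ∈ ({2, 3, 4, 5} : Set ℕ))
    (hbraid : a * b * a = b * a * b) (ha : IsOfFinOrder a) (hac : a ^ p ∈ Subgroup.center G)
    (hgen : Subgroup.closure {a, b} = ⊤) : Finite G := by
  obtain ⟨g, hg⟩ : ∃ g, g = a * b * a := ⟨_, rfl⟩
  have hga : g * a = b * g := by
    rw [hg]; nth_rewrite 1 [hbraid]; simp only [mul_assoc]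
  have hgb : g * b = a * g := by
    rw [hg]; nth_rewrite 2 [hbraid]; simp only [mul_assoc]
  have hgg : g * g ∈ Subgroup.center G := by
    have : (⊤ : Subgroup G) ≤ Subgroup.centralizer {g * g} := by
      rw [← hgen, Subgroup.closure_le]
      rintro y (rfl | rfl)
      · rw [SetLike.mem_coe, Subgroup.mem_centralizer_singleton_iff, ← mul_assoc, ← hgb,
          mul_assoc g b, ← hga, mul_assoc]
      · rw [SetLike.mem_coe, Subgroup.mem_centralizer_singleton_iff, ← mul_assoc, ← hga,
          mul_assoc g a, ← hgb, mul_assoc]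
    rw [Subgroup.mem_center_iff]
    intro y
    exact Subgroup.mem_centralizer_singleton_iff.mp (this (Subgroup.mem_top y))
  let π := QuotientGroup.mk' (Subgroup.center G)
  have hπ : ∀ {y}, y ∈ Subgroup.center G → π y = 1 := fun h =>
    (QuotientGroup.eq_one_iff _).mpr h
  have hb : b = a⁻¹ * g * a⁻¹ := by rw [hg]; group
  have hax : π g * π a * π g = (π a)⁻¹ * π g * (π a)⁻¹ := by
    have h1 : g * a * g = g * g * b := by rw [mul_assoc g g, hgb, mul_assoc]
    rw [← map_mul, ← map_mul, h1, map_mul, hπ hgg, one_mul, hb]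
    simp only [map_mul, map_inv]
  have hgen' : Subgroup.closure {π a, π g} = ⊤ := by
    rw [eq_top_iff, ← Subgroup.map_top_of_surjective π (QuotientGroup.mk'_surjective _), ← hgen,
      MonoidHom.map_closure, Subgroup.closure_le]
    have h1 : π a ∈ Subgroup.closure {π a, π g} := Subgroup.subset_closure (by simp)
    have h2 : π g ∈ Subgroup.closure {π a, π g} := Subgroup.subset_closure (by simp)
    rintro _ ⟨y, hy | hy, rfl⟩
    · exact hy ▸ h1
    · rw [hy, hb, map_mul, map_mul, map_inv]
      exact mul_mem (mul_mem (inv_mem h1) h2) (inv_mem h1)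
  have : Finite (G ⧸ Subgroup.center G) :=
    finite_of_triangle_relations hp (by rw [← map_pow, hπ hac]) (by rw [← map_mul, hπ hgg])
      hax hgen'
  exact finite_of_finite_quotient_center ha hga hgen

end FiniteGeneration

theorem stmt2 (d : ℕ) (hd : 1 ≤ d)
    (A B : Matrix (Fin d) (Fin d) ℂ) (hA : IsUnit A) (hB : IsUnit B)
    (hbraid : A * B * A = B * A * B)
    (h : ∃ p ∈ ({2, 3, 4, 5} : Set ℕ), ∃ c : ℂ,
      (∃ n : ℕ, 0 < n ∧ c ^ n = 1) ∧ A ^ p = c • (1 : Matrix (Fin d) (Fin d) ℂ)) :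
    Set.Finite (matGenGroup A B : Set (Matrix (Fin d) (Fin d) ℂ)ˣ) := by
  obtain ⟨p, hp, c, ⟨n, hn, hc⟩, hAp⟩ := h
  obtain ⟨a, rfl⟩ := hA
  obtain ⟨b, rfl⟩ := hB
  have hset : {g : (Matrix (Fin d) (Fin d) ℂ)ˣ | (g : Matrix (Fin d) (Fin d) ℂ) = a ∨
      (g : Matrix (Fin d) (Fin d) ℂ) = b} = {a, b} := by
    ext g
    simp [Units.val_inj]
  rw [matGenGroup, hset]
  have hp0 : 0 < p := by
    rcases hp with rfl | rfl | rfl | rfl <;> norm_num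
  let K := Subgroup.closure ({a, b} : Set (Matrix (Fin d) (Fin d) ℂ)ˣ)
  let a' : K := ⟨a, Subgroup.subset_closure (by simp)⟩
  let b' : K := ⟨b, Subgroup.subset_closure (by simp)⟩
  have hfin : Finite K := by
    refine finite_of_braid_s2 (a := a') (b := b') hp ?_ ?_ ?_ ?_
    · exact Subtype.ext (Units.ext hbraid)
    · rw [isOfFinOrder_iff_pow_eq_one]
      refine ⟨p * n, Nat.mul_pos hp0 hn, Subtype.ext (Units.ext ?_)⟩
      simp [a', pow_mul, hAp, smul_pow, hc]
    · rw [Subgroup.mem_center_iff]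
      intro y
      refine Subtype.ext (Units.ext ?_)
      simp [a', hAp]
    · have := Subgroup.closure_closure_coe_preimage (k := ({a, b} : Set (Matrix (Fin d) (Fin d) ℂ)ˣ))
      convert this using 2
      ext y
      simp [a', b', Subtype.ext_iff]
  exact hfin
end

section
/- Let d be an integer with 2 ≤ d ≤ 5. Let π₁, π₂ be permutations of {1,…,d}, let D₁, D₂ be invertible diagonal d×d complex matrices, and set A = D₁·P(π₁) and B = D₂·P(π₂), where P(π) denotes the permutation matrix of π. Suppose A*B*A = B*A*B, the pair (A,B) is irreducible, and every eigenvalue of A is a root of unity. Then the subgroup of GL(d,ℂ) generated by A and B is finite. -/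
/-- The self-maps of `Fin 5` representing the conjugacy classes of permutations. -/
def conjReps : List (Fin 5 → Fin 5) :=
  [![0, 1, 2, 3, 4], ![1, 0, 2, 3, 4], ![1, 0, 3, 2, 4], ![1, 2, 0, 3, 4], ![1, 2, 0, 4, 3],
    ![1, 2, 3, 0, 4], ![1, 2, 3, 4, 0]]

/-- Tuples `(s, t, k, p, q)`, where `(s, t)` runs through the pairs of permutations satisfying the
braid relation with `s` in `conjReps`, and `(k, p, q)` are the data of a potential as in
`IsPotentialData`. -/
def braidTable : List ((Fin 5 → Fin 5) × (Fin 5 → Fin 5) × Fin 5 × Fin 5 × Fin 5) :=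
  [(![0, 1, 2, 3, 4], ![0, 1, 2, 3, 4], 0, 0, 0),
    (![1, 0, 2, 3, 4], ![0, 2, 1, 3, 4], 2, 1, 2),
    (![1, 0, 2, 3, 4], ![0, 3, 2, 1, 4], 3, 1, 3),
    (![1, 0, 2, 3, 4], ![0, 4, 2, 3, 1], 4, 1, 4),
    (![1, 0, 2, 3, 4], ![1, 0, 2, 3, 4], 0, 0, 0),
    (![1, 0, 2, 3, 4], ![2, 1, 0, 3, 4], 2, 0, 2),
    (![1, 0, 2, 3, 4], ![3, 1, 2, 0, 4], 3, 0, 3),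
    (![1, 0, 2, 3, 4], ![4, 1, 2, 3, 0], 4, 0, 4),
    (![1, 0, 3, 2, 4], ![0, 4, 3, 2, 1], 4, 1, 4),
    (![1, 0, 3, 2, 4], ![1, 0, 2, 4, 3], 4, 3, 4),
    (![1, 0, 3, 2, 4], ![1, 0, 3, 2, 4], 0, 0, 0),
    (![1, 0, 3, 2, 4], ![1, 0, 4, 3, 2], 4, 2, 4),
    (![1, 0, 3, 2, 4], ![4, 1, 3, 2, 0], 4, 0, 4),
    (![1, 2, 0, 3, 4], ![0, 3, 1, 2, 4], 3, 1, 3),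
    (![1, 2, 0, 3, 4], ![0, 4, 1, 3, 2], 4, 1, 4),
    (![1, 2, 0, 3, 4], ![1, 2, 0, 3, 4], 0, 0, 0),
    (![1, 2, 0, 3, 4], ![2, 1, 3, 0, 4], 3, 2, 3),
    (![1, 2, 0, 3, 4], ![2, 1, 4, 3, 0], 4, 2, 4),
    (![1, 2, 0, 3, 4], ![3, 0, 2, 1, 4], 3, 0, 3),
    (![1, 2, 0, 3, 4], ![4, 0, 2, 3, 1], 4, 0, 4),
    (![1, 2, 0, 4, 3], ![1, 2, 0, 4, 3], 0, 0, 0),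
    (![1, 2, 3, 0, 4], ![1, 2, 3, 0, 4], 0, 0, 0),
    (![1, 2, 3, 0, 4], ![1, 3, 0, 2, 4], 0, 0, 0),
    (![1, 2, 3, 0, 4], ![2, 0, 3, 1, 4], 0, 0, 0),
    (![1, 2, 3, 0, 4], ![2, 3, 1, 0, 4], 0, 0, 0),
    (![1, 2, 3, 0, 4], ![3, 2, 0, 1, 4], 0, 0, 0),
    (![1, 2, 3, 4, 0], ![1, 2, 3, 4, 0], 0, 0, 0),
    (![1, 2, 3, 4, 0], ![2, 0, 4, 1, 3], 0, 0, 0),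
    (![1, 2, 3, 4, 0], ![2, 4, 1, 0, 3], 0, 0, 0),
    (![1, 2, 3, 4, 0], ![3, 0, 4, 2, 1], 0, 0, 0),
    (![1, 2, 3, 4, 0], ![4, 3, 0, 2, 1], 0, 0, 0),
    (![1, 2, 3, 4, 0], ![4, 3, 1, 0, 2], 0, 0, 0)]

/-- For every `v` satisfying the linearised braid relation, the function supported at `k` with value
`v q - v p` is `s`-invariant and has the same coboundary along `t` as `v`. -/
def IsPotentialData (V : Type*) [AddCommGroup V] (s t : Fin 5 → Fin 5) (k p q : Fin 5) : Prop :=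
  ∀ v : Fin 5 → V,
    (∀ i, v (s i) - v (t (s i)) = v i - v (t i) + (v (s (t i)) - v (t (s (t i))))) →
    ∀ i, (if s i = k then v q - v p else 0) = (if i = k then v q - v p else 0) ∧
      v i - v (t i) = (if i = k then v q - v p else 0) - (if t i = k then v q - v p else 0)

theorem exists_conj_mem_conjReps (σ : Equiv.Perm (Fin 5)) :
    ∃ ρ : Equiv.Perm (Fin 5), ⇑(ρ * σ * ρ⁻¹) ∈ conjReps := by
  decide +revert +kernel

theorem exists_mem_braidTable : ∀ s ∈ conjReps, ∀ τ : Equiv.Perm (Fin 5),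
    (∀ i, s (τ (s i)) = τ (s (τ i))) → ∃ x ∈ braidTable, x.1 = s ∧ x.2.1 = ⇑τ := by
  decide +kernel

set_option maxHeartbeats 1000000 in
theorem isPotentialData_rat_of_mem {s t : Fin 5 → Fin 5} {k p q : Fin 5}
    (h : (s, t, k, p, q) ∈ braidTable) : IsPotentialData ℚ s t k p q := by
  simp only [braidTable, List.mem_cons, List.not_mem_nil, or_false, Prod.mk.injEq] at h
  rcases h with h | h | h | h | h | h | h | h | h | h | h | h | h | h | h | h | h | h | h | h | h |
      h | h | h | h | h | h | h | h | h | h | h <;>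
  · obtain ⟨rfl, rfl, rfl, rfl, rfl⟩ := h
    intro v h
    simp [Fin.forall_fin_succ] at h ⊢ <;> grind

theorem IsPotentialData.of_rat {V : Type*} [AddCommGroup V] [Module ℚ V] {s t : Fin 5 → Fin 5}
    {k p q : Fin 5} (h : IsPotentialData ℚ s t k p q) : IsPotentialData V s t k p q := by
  intro v hv i
  have key (φ : V →ₗ[ℚ] ℚ) := h (fun j => φ (v j)) (fun j => by
    simpa only [map_sub, map_add] using congrArg φ (hv j)) i
  constructor
  · rw [← sub_eq_zero, ← Module.forall_dual_apply_eq_zero_iff ℚ]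
    intro φ
    rw [map_sub, sub_eq_zero]
    simpa only [apply_ite φ, map_sub, map_zero] using (key φ).1
  · rw [← sub_eq_zero, ← Module.forall_dual_apply_eq_zero_iff ℚ]
    intro φ
    rw [map_sub, sub_eq_zero]
    simpa only [apply_ite φ, map_sub, map_zero] using (key φ).2

/-- A coboundary along `τ` which satisfies the linearised braid relation is the coboundary of a
`σ`-invariant function. -/
theorem exists_invariant_potential {V : Type*} [AddCommGroup V] [Module ℚ V]
    (σ τ : Equiv.Perm (Fin 5)) (hb : ∀ i, σ (τ (σ i)) = τ (σ (τ i))) (v : Fin 5 → V)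
    (hv : ∀ i, v (σ i) - v (τ (σ i)) = v i - v (τ i) + (v (σ (τ i)) - v (τ (σ (τ i))))) :
    ∃ u : Fin 5 → V, ∀ i, u (σ i) = u i ∧ v i - v (τ i) = u i - u (τ i) := by
  obtain ⟨ρ, hρ⟩ := exists_conj_mem_conjReps σ
  obtain ⟨⟨s, t, k, p, q⟩, hx, hs, ht⟩ :=
    exists_mem_braidTable _ hρ (ρ * τ * ρ⁻¹) (fun i => by simp [hb])
  dsimp only at hs ht
  subst hs ht
  have := (isPotentialData_rat_of_mem hx).of_rat (V := V) (fun i => v (ρ⁻¹ i))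
    (fun i => by simpa using hv (ρ⁻¹ i))
  refine ⟨fun i => if ρ i = k then v (ρ⁻¹ q) - v (ρ⁻¹ p) else 0, fun i => ?_⟩
  simpa using this (ρ i)

theorem exists_invariant_potential_of_le {V : Type*} [AddCommGroup V] [Module ℚ V] {d : ℕ}
    (hd : d ≤ 5) (σ τ : Equiv.Perm (Fin d)) (hb : ∀ i, σ (τ (σ i)) = τ (σ (τ i))) (v : Fin d → V)
    (hv : ∀ i, v (σ i) - v (τ (σ i)) = v i - v (τ i) + (v (σ (τ i)) - v (τ (σ (τ i))))) :
    ∃ u : Fin d → V, ∀ i, u (σ i) = u i ∧ v i - v (τ i) = u i - u (τ i) := by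
  let e : Fin d ↪ Fin 5 := Fin.castLEEmb hd
  have hσ (i) : σ.viaFintypeEmbedding e (e i) = e (σ i) :=
    Equiv.Perm.viaFintypeEmbedding_apply_image _ _ _
  have hτ (i) : τ.viaFintypeEmbedding e (e i) = e (τ i) :=
    Equiv.Perm.viaFintypeEmbedding_apply_image _ _ _
  have hσ' (i) (h : i ∉ Set.range e) : σ.viaFintypeEmbedding e i = i :=
    Equiv.Perm.viaFintypeEmbedding_apply_notMem_range _ _ h
  have hτ' (i) (h : i ∉ Set.range e) : τ.viaFintypeEmbedding e i = i :=
    Equiv.Perm.viaFintypeEmbedding_apply_notMem_range _ _ h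
  have hext (i) : Function.extend e v 0 (e i) = v i := e.injective.extend_apply _ _ _
  obtain ⟨u, hu⟩ := exists_invariant_potential (σ.viaFintypeEmbedding e) (τ.viaFintypeEmbedding e)
    (fun i => by
      by_cases h : i ∈ Set.range e
      · obtain ⟨j, rfl⟩ := h
        simp only [hσ, hτ, hb]
      · simp only [hσ' i h, hτ' i h])
    (Function.extend e v 0) (fun i => by
      by_cases h : i ∈ Set.range e
      · obtain ⟨j, rfl⟩ := h
        simpa only [hσ, hτ, hext] using hv j
      · simp only [hσ' i h, hτ' i h, sub_self, add_zero])
  refine ⟨fun i => u (e i), fun i => ?_⟩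
  simpa only [hσ, hτ, hext] using hu (e i)

/-- A function whose sum over every cycle of `σ` vanishes is a coboundary along `σ`. -/
theorem exists_sub_comp_eq {ι V : Type*} [AddCommGroup V] [Module ℚ V] (σ : Equiv.Perm ι) {m : ℕ}
    (hm : 0 < m) (a : ι → V) (ha : ∀ i, ∑ k ∈ Finset.range m, a ((σ ^ k) i) = 0) :
    ∃ w : ι → V, ∀ i, a i = w i - w (σ i) := by
  let S (k : ℕ) (i : ι) : V := ∑ j ∈ Finset.range k, a ((σ ^ j) i)
  have hS (k i) : S (k + 1) i = S k (σ i) + a i := by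
    simp [S, Finset.sum_range_succ', pow_succ]
  have hU (i) : ∑ k ∈ Finset.range m, S k i = ∑ k ∈ Finset.range m, S k (σ i) + m • a i := by
    have h1 := Finset.sum_range_succ (fun k => S k i) m
    have h2 := Finset.sum_range_succ' (fun k => S k i) m
    simp only [hS, Finset.sum_add_distrib, Finset.sum_const, Finset.card_range] at h2
    have h3 : S m i = 0 := ha i
    have h4 : S 0 i = 0 := by simp [S]
    rw [h3, add_zero] at h1
    rw [h4, add_zero] at h2
    rw [← h1, h2]
  refine ⟨fun i => (m : ℚ)⁻¹ • ∑ k ∈ Finset.range m, S k i, fun i => ?_⟩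
  have hm' : (m : ℚ) ≠ 0 := by positivity
  dsimp only
  rw [hU i, smul_add, add_sub_cancel_left, ← Nat.cast_smul_eq_nsmul ℚ, inv_smul_smul₀ hm']

/-- The target of the logarithm modulo roots of unity. -/
abbrev LogQuotient : Type := ℂ ⧸ LinearMap.range (Algebra.linearMap ℚ ℂ)

/-- The logarithm `z ↦ log z / (2πi)` modulo rational numbers. -/
noncomputable def logQuotient (z : ℂ) : LogQuotient :=
  Submodule.Quotient.mk (Complex.log z / (2 * Real.pi * Complex.I))

theorem logQuotient_exp (x : ℂ) :
    logQuotient (Complex.exp (2 * Real.pi * Complex.I * x)) = Submodule.Quotient.mk x := by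
  have h := Complex.exp_log (Complex.exp_ne_zero (2 * Real.pi * Complex.I * x))
  obtain ⟨n, hn⟩ := Complex.exp_eq_exp_iff_exists_int.1 h
  rw [logQuotient, Submodule.Quotient.eq, hn]
  refine ⟨n, ?_⟩
  have := Complex.two_pi_I_ne_zero
  simp only [Algebra.linearMap_apply, eq_ratCast, Rat.cast_intCast]
  field_simp
  ring

theorem exists_exp_eq {z : ℂ} (hz : z ≠ 0) :
    ∃ x : ℂ, Complex.exp (2 * Real.pi * Complex.I * x) = z :=
  ⟨Complex.log z / (2 * Real.pi * Complex.I), by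
    rw [mul_div_cancel₀ _ Complex.two_pi_I_ne_zero, Complex.exp_log hz]⟩

theorem logQuotient_mul {z w : ℂ} (hz : z ≠ 0) (hw : w ≠ 0) :
    logQuotient (z * w) = logQuotient z + logQuotient w := by
  obtain ⟨x, rfl⟩ := exists_exp_eq hz
  obtain ⟨y, rfl⟩ := exists_exp_eq hw
  rw [← Complex.exp_add, ← mul_add]
  simp only [logQuotient_exp, Submodule.Quotient.mk_add]

theorem logQuotient_one : logQuotient 1 = 0 := by
  simp [logQuotient]

theorem logQuotient_div {z w : ℂ} (hz : z ≠ 0) (hw : w ≠ 0) :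
    logQuotient (z / w) = logQuotient z - logQuotient w := by
  rw [eq_sub_iff_add_eq, ← logQuotient_mul (div_ne_zero hz hw) hw, div_mul_cancel₀ _ hw]

theorem logQuotient_prod {ι : Type*} (s : Finset ι) (f : ι → ℂ) (hf : ∀ i, f i ≠ 0) :
    logQuotient (∏ i ∈ s, f i) = ∑ i ∈ s, logQuotient (f i) := by
  classical
  induction s using Finset.induction_on with
  | empty => simp [logQuotient_one]
  | insert a s ha ih =>
    rw [Finset.prod_insert ha, Finset.sum_insert ha,
      logQuotient_mul (hf a) (Finset.prod_ne_zero_iff.2 fun i _ => hf i), ih]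

theorem logQuotient_eq_zero_iff {z : ℂ} (hz : z ≠ 0) :
    logQuotient z = 0 ↔ ∃ n : ℕ, 0 < n ∧ z ^ n = 1 := by
  constructor
  · obtain ⟨x, rfl⟩ := exists_exp_eq hz
    rw [logQuotient_exp, Submodule.Quotient.mk_eq_zero]
    rintro ⟨q, rfl⟩
    refine ⟨q.den, q.den_pos, ?_⟩
    rw [← Complex.exp_nat_mul, Complex.exp_eq_one_iff]
    refine ⟨q.num, ?_⟩
    have : (q : ℂ) * q.den = q.num := by exact_mod_cast q.mul_den_eq_num
    rw [Algebra.linearMap_apply, eq_ratCast, ← this]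
    ring
  · rintro ⟨n, hn, h⟩
    have h1 := logQuotient_prod (Finset.range n) (fun _ => z) (fun _ => hz)
    rw [Finset.prod_const, Finset.sum_const, Finset.card_range, h, logQuotient_one,
      ← Nat.cast_smul_eq_nsmul ℚ] at h1
    exact (smul_eq_zero.1 h1.symm).resolve_left (by positivity)

theorem exists_logQuotient_eq (y : LogQuotient) : ∃ z : ℂ, z ≠ 0 ∧ logQuotient z = y := by
  obtain ⟨x, rfl⟩ := Submodule.Quotient.mk_surjective _ y
  exact ⟨_, Complex.exp_ne_zero _, logQuotient_exp x⟩

theorem exists_common_exponent {ι : Type*} [Fintype ι] (z : ι → ℂ)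
    (h : ∀ i, ∃ n : ℕ, 0 < n ∧ z i ^ n = 1) :
    ∃ N : ℕ, N ≠ 0 ∧ ∀ i, z i ^ N = 1 := by
  choose n hn hz using h
  refine ⟨∏ i, n i, Finset.prod_ne_zero_iff.2 fun i _ => (hn i).ne', fun i => ?_⟩
  obtain ⟨k, hk⟩ := Finset.dvd_prod_of_mem n (Finset.mem_univ i)
  rw [hk, pow_mul, hz, one_pow]

/-- If the logarithms of `f` modulo roots of unity form the coboundary of those of `c`, then `f` is
a coboundary up to roots of unity of a common order. -/
theorem exists_pow_eq_one_of_logQuotient {ι : Type*} [Fintype ι] (c : ι → ℂ)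
    (hc : ∀ i, c i ≠ 0) (π : Equiv.Perm ι) (f : ι → ℂ) (hf : ∀ i, f i ≠ 0)
    (h : ∀ i, logQuotient (f i) = logQuotient (c i) - logQuotient (c (π i))) :
    ∃ N : ℕ, N ≠ 0 ∧ ∀ i, (f i * (c (π i) / c i)) ^ N = 1 := by
  refine exists_common_exponent _ fun i => ?_
  rw [← logQuotient_eq_zero_iff (mul_ne_zero (hf i) (div_ne_zero (hc _) (hc _))),
    logQuotient_mul (hf i) (div_ne_zero (hc _) (hc _)), logQuotient_div (hc _) (hc _), h]
  abel

section Monomial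

variable {ι : Type*} [DecidableEq ι]

/-- The generalized permutation matrix whose entry at `(i, π i)` is `f i`. -/
def monomialMatrix (π : Equiv.Perm ι) (f : ι → ℂ) : Matrix ι ι ℂ :=
  Matrix.of fun i j => if π i = j then f i else 0

theorem monomialMatrix_inj {π ρ : Equiv.Perm ι} {f g : ι → ℂ} (hf : ∀ i, f i ≠ 0)
    (h : monomialMatrix π f = monomialMatrix ρ g) (i : ι) : ρ i = π i ∧ f i = g i := by
  have h1 := congrFun (congrFun h i) (π i)
  simp only [monomialMatrix, Matrix.of_apply, if_true] at h1
  split_ifs at h1 with h2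
  · exact ⟨h2, h1⟩
  · exact absurd h1 (hf i)

theorem monomialMatrix_one : monomialMatrix (1 : Equiv.Perm ι) (fun _ => 1) = 1 := by
  ext i j
  by_cases h : i = j <;> simp [monomialMatrix, Matrix.one_apply, h]

variable [Fintype ι]

theorem isDiag_mul_permMatrix {D : Matrix ι ι ℂ} (hD : D.IsDiag) (π : Equiv.Perm ι) :
    D * Equiv.Perm.permMatrix ℂ π = monomialMatrix π (fun i => D i i) := by
  obtain ⟨f, rfl⟩ : ∃ f, D = Matrix.diagonal f := ⟨_, hD.diagonal_diag.symm⟩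
  ext i j
  simp [monomialMatrix, Matrix.diagonal_mul, Equiv.Perm.permMatrix, PEquiv.toMatrix_apply, eq_comm]

theorem monomialMatrix_mul (π ρ : Equiv.Perm ι) (f g : ι → ℂ) :
    monomialMatrix π f * monomialMatrix ρ g =
      monomialMatrix (ρ * π) (fun i => f i * g (π i)) := by
  ext i j
  simp only [monomialMatrix, Matrix.mul_apply, Matrix.of_apply]
  rw [Finset.sum_eq_single (π i) (fun k _ hk => by simp [hk.symm]) (by simp)]
  by_cases h : ρ (π i) = j <;> simp [h]

theorem monomialMatrix_pow (π : Equiv.Perm ι) (f : ι → ℂ) (m : ℕ) :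
    monomialMatrix π f ^ m =
      monomialMatrix (π ^ m) (fun i => ∏ k ∈ Finset.range m, f ((π ^ k) i)) := by
  induction m with
  | zero => simp [monomialMatrix_one]
  | succ m ih =>
    rw [pow_succ, ih, monomialMatrix_mul, ← pow_succ']
    simp only [Finset.prod_range_succ]

/-- If all eigenvalues of a monomial matrix are roots of unity, its logarithms modulo roots of unity
form a coboundary. -/
theorem exists_logQuotient_eq_sub (π : Equiv.Perm ι) (f : ι → ℂ) (hf : ∀ i, f i ≠ 0)
    (h : ∀ μ ∈ spectrum ℂ (monomialMatrix π f), ∃ n : ℕ, 0 < n ∧ μ ^ n = 1) :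
    ∃ w : ι → LogQuotient, ∀ i, logQuotient (f i) = w i - w (π i) := by
  refine exists_sub_comp_eq π (orderOf_pos π) _ fun i => ?_
  rw [← logQuotient_prod _ (fun k => f ((π ^ k) i)) (fun _ => hf _),
    logQuotient_eq_zero_iff (Finset.prod_ne_zero_iff.2 fun _ _ => hf _)]
  have hdiag : monomialMatrix π f ^ orderOf π =
      Matrix.diagonal (fun i => ∏ k ∈ Finset.range (orderOf π), f ((π ^ k) i)) := by
    rw [monomialMatrix_pow, pow_orderOf_eq_one]
    ext i j
    by_cases h : i = j <;> simp [monomialMatrix, h]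
  have hmem : ∏ k ∈ Finset.range (orderOf π), f ((π ^ k) i) ∈
      spectrum ℂ (monomialMatrix π f ^ orderOf π) := by
    rw [hdiag, spectrum_diagonal]
    exact ⟨i, rfl⟩
  rw [spectrum.map_pow_of_pos _ (orderOf_pos π)] at hmem
  obtain ⟨μ, hμ, hμ'⟩ := hmem
  obtain ⟨n, hn, hn'⟩ := h μ hμ
  refine ⟨n, hn, ?_⟩
  rw [← hμ', ← pow_mul, mul_comm, pow_mul, hn', one_pow]

/-- The group of monomial matrices which, after conjugation by the diagonal matrix with
entries `c`, have `N`-th roots of unity as nonzero entries. -/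
def rootMonomialGroup (c : ι → ℂ) (hc : ∀ i, c i ≠ 0) {N : ℕ} (hN : N ≠ 0) :
    Subgroup (Matrix ι ι ℂ)ˣ where
  carrier := {g | ∃ (π : Equiv.Perm ι) (f : ι → ℂ),
    (g : Matrix ι ι ℂ) = monomialMatrix π f ∧ ∀ i, (f i * (c (π i) / c i)) ^ N = 1}
  one_mem' := ⟨1, fun _ => 1, monomialMatrix_one.symm, fun i => by simp [hc i]⟩
  mul_mem' := by
    rintro g g' ⟨π, f, hg, hf⟩ ⟨π', f', hg', hf'⟩
    refine ⟨π' * π, fun i => f i * f' (π i), ?_, fun i => ?_⟩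
    · rw [Units.val_mul, hg, hg', monomialMatrix_mul]
    · have := congrArg₂ (· * ·) (hf i) (hf' (π i))
      simp only [← mul_pow, mul_one] at this
      rw [← this, Equiv.Perm.mul_apply]
      have := hc i
      have := hc (π i)
      field_simp
  inv_mem' := by
    rintro g ⟨π, f, hg, hf⟩
    have hf0 (i) : f i ≠ 0 := fun h => by simpa [h, hN] using hf i
    refine ⟨π⁻¹, fun i => (f (π⁻¹ i))⁻¹, ?_, fun i => ?_⟩
    · refine Units.inv_eq_of_mul_eq_one_right ?_
      rw [hg, monomialMatrix_mul, ← monomialMatrix_one]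
      congr 1
      · simp
      · ext i
        simp [hf0 i]
    · have := hf (π⁻¹ i)
      rw [← Equiv.Perm.mul_apply, mul_inv_cancel, Equiv.Perm.one_apply] at this
      rw [← inv_inj, ← inv_pow, inv_one, ← this]
      simp [mul_comm]

theorem finite_rootMonomialGroup (c : ι → ℂ) (hc : ∀ i, c i ≠ 0) {N : ℕ} (hN : N ≠ 0) :
    (rootMonomialGroup c hc hN : Set (Matrix ι ι ℂ)ˣ).Finite := by
  have hroots : {z : ℂ | z ^ N = 1}.Finite :=
    (Polynomial.nthRoots N (1 : ℂ)).toFinset.finite_toSet.subset fun z hz => by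
      simpa [Polynomial.mem_nthRoots (Nat.pos_of_ne_zero hN)] using hz
  have hfin (π : Equiv.Perm ι) : {f : ι → ℂ | ∀ i, (f i * (c (π i) / c i)) ^ N = 1}.Finite := by
    have := Set.Finite.pi' (t := fun i => {z : ℂ | (z * (c (π i) / c i)) ^ N = 1}) fun i =>
      hroots.preimage (f := fun z => z * (c (π i) / c i))
        (mul_left_injective₀ (div_ne_zero (hc _) (hc _))).injOn
    exact this
  refine Set.Finite.of_finite_image (f := Units.val) (Set.Finite.subset
    (Set.finite_iUnion fun π => (hfin π).image (monomialMatrix π)) ?_) Units.val_injective.injOn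
  rintro _ ⟨g, ⟨π, f, hg, hf⟩, rfl⟩
  exact Set.mem_iUnion.2 ⟨π, f, hf, hg.symm⟩

end Monomial

theorem finite_matGenGroup_of_monomialMatrix {d : ℕ} (hd5 : d ≤ 5) {π₁ π₂ : Equiv.Perm (Fin d)}
    {f g : Fin d → ℂ} (hf : ∀ i, f i ≠ 0) (hg : ∀ i, g i ≠ 0)
    {A B : Matrix (Fin d) (Fin d) ℂ} (hA : A = monomialMatrix π₁ f) (hB : B = monomialMatrix π₂ g)
    {uA uB : (Matrix (Fin d) (Fin d) ℂ)ˣ} (huA : uA = A) (huB : uB = B)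
    (hbraid : A * B * A = B * A * B)
    (hrou : ∀ μ ∈ spectrum ℂ A, ∃ n : ℕ, 0 < n ∧ μ ^ n = 1) :
    (matGenGroup A B : Set (Matrix (Fin d) (Fin d) ℂ)ˣ).Finite := by
  have hspec : spectrum ℂ B = spectrum ℂ A := by
    have : (uA * uB) * uA * (uA * uB)⁻¹ = uB := by
      rw [mul_inv_eq_iff_eq_mul, ← mul_assoc]
      ext1
      simpa [huA, huB] using hbraid
    rw [← huA, ← huB, ← this]
    simpa using spectrum.units_conjugate (R := ℂ) (a := (uA : Matrix (Fin d) (Fin d) ℂ))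
      (u := uA * uB)
  obtain ⟨w, hw⟩ := exists_logQuotient_eq_sub π₁ f hf (hA ▸ hrou)
  obtain ⟨w', hw'⟩ := exists_logQuotient_eq_sub π₂ g hg (hB ▸ hspec ▸ hrou)
  simp only [hA, hB, monomialMatrix_mul] at hbraid
  have hperm (i) := (monomialMatrix_inj
    (fun i => mul_ne_zero (mul_ne_zero (hf _) (hg _)) (hf _)) hbraid i).1.symm
  have hentry (i) := congrArg logQuotient (monomialMatrix_inj
    (fun i => mul_ne_zero (mul_ne_zero (hf _) (hg _)) (hf _)) hbraid i).2
  simp only [Equiv.Perm.mul_apply] at hperm hentry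
  have hrel (i) : (w' - w) (π₁ i) - (w' - w) (π₂ (π₁ i)) = (w' - w) i - (w' - w) (π₂ i) +
      ((w' - w) (π₁ (π₂ i)) - (w' - w) (π₂ (π₁ (π₂ i)))) := by
    have h := hentry i
    rw [logQuotient_mul (mul_ne_zero (hf _) (hg _)) (hf _), logQuotient_mul (hf _) (hg _),
      logQuotient_mul (mul_ne_zero (hg _) (hf _)) (hg _), logQuotient_mul (hg _) (hf _)] at h
    simp only [hw, hw', hperm] at h
    simp only [Pi.sub_apply]
    rw [← sub_eq_zero] at h ⊢
    rw [← h]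
    abel
  obtain ⟨u, hu⟩ := exists_invariant_potential_of_le hd5 π₁ π₂ hperm (w' - w) hrel
  choose c hc hcu using fun i => exists_logQuotient_eq (w i + u i)
  obtain ⟨N, hN, hfN⟩ := exists_pow_eq_one_of_logQuotient c hc π₁ f hf fun i => by
    rw [hw, hcu, hcu, (hu i).1]
    abel
  obtain ⟨M, hM, hgM⟩ := exists_pow_eq_one_of_logQuotient c hc π₂ g hg fun i => by
    have h := (hu i).2
    simp only [Pi.sub_apply] at h
    rw [hw', hcu, hcu, add_sub_add_comm, ← h]
    abel
  refine (finite_rootMonomialGroup c hc (mul_ne_zero hN hM)).subset ?_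
  refine (Subgroup.closure_le _).2 ?_
  rintro x (hx | hx)
  · exact ⟨π₁, f, hx.trans hA, fun i => by rw [pow_mul, hfN, one_pow]⟩
  · exact ⟨π₂, g, hx.trans hB, fun i => by rw [mul_comm N, pow_mul, hgM, one_pow]⟩

theorem stmt4 (d : ℕ) (hd2 : 2 ≤ d) (hd5 : d ≤ 5)
    (π₁ π₂ : Equiv.Perm (Fin d)) (D₁ D₂ : Matrix (Fin d) (Fin d) ℂ)
    (hD₁diag : D₁.IsDiag) (hD₂diag : D₂.IsDiag) (hD₁ : IsUnit D₁) (hD₂ : IsUnit D₂)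
    (A B : Matrix (Fin d) (Fin d) ℂ)
    (hA : A = D₁ * Equiv.Perm.permMatrix ℂ π₁)
    (hB : B = D₂ * Equiv.Perm.permMatrix ℂ π₂)
    (hbraid : A * B * A = B * A * B)
    (hirr : MatPairIrreducible A B)
    (hrou : ∀ μ ∈ spectrum ℂ A, ∃ n : ℕ, 0 < n ∧ μ ^ n = 1) :
    Set.Finite (matGenGroup A B : Set (Matrix (Fin d) (Fin d) ℂ)ˣ) := by
  have hf (i) : D₁ i i ≠ 0 := by
    have := (Matrix.isUnit_iff_isUnit_det _).1 hD₁
    rw [← hD₁diag.diagonal_diag, Matrix.det_diagonal] at this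
    exact Finset.prod_ne_zero_iff.1 this.ne_zero i (Finset.mem_univ i)
  have hg (i) : D₂ i i ≠ 0 := by
    have := (Matrix.isUnit_iff_isUnit_det _).1 hD₂
    rw [← hD₂diag.diagonal_diag, Matrix.det_diagonal] at this
    exact Finset.prod_ne_zero_iff.1 this.ne_zero i (Finset.mem_univ i)
  have hunit (π : Equiv.Perm (Fin d)) : IsUnit (Equiv.Perm.permMatrix ℂ π) := by
    simp [Matrix.isUnit_iff_isUnit_det]
  obtain ⟨uA, huA⟩ : IsUnit A := hA ▸ hD₁.mul (hunit π₁)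
  obtain ⟨uB, huB⟩ : IsUnit B := hB ▸ hD₂.mul (hunit π₂)
  rw [isDiag_mul_permMatrix hD₁diag] at hA
  rw [isDiag_mul_permMatrix hD₂diag] at hB
  exact finite_matGenGroup_of_monomialMatrix hd5 hf hg hA hB huA huB hbraid hrou
end

section
/- Let A, B be invertible 2×2 complex matrices satisfying the braid relation A*B*A = B*A*B, such that the pair (A,B) is irreducible and the subgroup G of GL(2,ℂ) generated by A and B is primitive. If A^t is not a scalar matrix for every t ∈ {1,2,3,4,5} (i.e., the projective order of A is at least 6), then G is infinite. -/
/-- A subgroup `G ≤ GL(d, ℂ)` is imprimitive if there are `n ≥ 2` nonzero subspaces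
`V₁, …, Vₙ` of `ℂ^d` whose internal direct sum is `ℂ^d`, such that every element of `G`
maps each `Vᵢ` onto some `Vⱼ`, and some element of `G` maps some `Vᵢ` onto `Vⱼ` with
`j ≠ i`. -/
def MatGroupImprimitive {d : ℕ} (G : Subgroup (Matrix (Fin d) (Fin d) ℂ)ˣ) : Prop :=
  ∃ n : ℕ, 2 ≤ n ∧ ∃ V : Fin n → Submodule ℂ (Fin d → ℂ),
    (∀ i, V i ≠ ⊥) ∧ iSupIndep V ∧ (⨆ i, V i) = ⊤ ∧
    (∀ g ∈ G, ∀ i, ∃ j,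
      (V i).map (Matrix.mulVecLin (g : Matrix (Fin d) (Fin d) ℂ)) = V j) ∧
    (∃ g ∈ G, ∃ i j, i ≠ j ∧
      (V i).map (Matrix.mulVecLin (g : Matrix (Fin d) (Fin d) ℂ)) = V j)

theorem Matrix.mul_mul_self_of_idempotent_trace_one {P : Matrix (Fin 2) (Fin 2) ℂ}
    (hP : P * P = P) (ht : P.trace = 1) (X : Matrix (Fin 2) (Fin 2) ℂ) :
    P * X * P = (P * X).trace • P := by
  have h00 := congrFun (congrFun hP 0) 0
  simp only [Matrix.mul_apply, Fin.sum_univ_two] at h00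
  rw [Matrix.trace_fin_two] at ht
  have h1 : P 1 1 = 1 - P 0 0 := by linear_combination ht
  ext i j
  fin_cases i <;> fin_cases j <;>
    simp [Matrix.mul_apply, Matrix.trace_fin_two, Fin.sum_univ_two, h1]
  · linear_combination X 1 1 * h00
  · linear_combination -X 0 1 * h00
  · linear_combination -X 1 0 * h00
  · linear_combination X 0 0 * h00

theorem Matrix.trace_mul_conj_of_idempotent {P Q : Matrix (Fin 2) (Fin 2) ℂ}
    (hQ : Q * Q = Q) (hQt : Q.trace = 1) (u v : ℂ) :
    (Q * ((1 + u • P) * Q * (1 + v • P))).trace =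
      1 + (u + v) * (P * Q).trace + u * v * (P * Q).trace ^ 2 := by
  have h := Matrix.mul_mul_self_of_idempotent_trace_one hQ hQt P
  have e : Q * ((1 + u • P) * Q * (1 + v • P)) =
      Q * Q + u • (Q * P * Q) + v • (Q * Q * P) + (u * v) • (Q * P * Q * P) := by
    simp only [mul_add, add_mul, mul_one, one_mul, Matrix.mul_smul, Matrix.smul_mul, smul_smul,
      mul_assoc]
    rw [mul_comm v u]
    abel
  rw [e, h, hQ]
  simp only [Matrix.trace_add, Matrix.trace_smul, Matrix.smul_mul, hQt, Matrix.trace_mul_comm Q P,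
    smul_eq_mul]
  ring

theorem Matrix.smul_one_add_smul_pow {P : Matrix (Fin 2) (Fin 2) ℂ} (hP : P * P = P)
    (l r : ℂ) (m : ℕ) :
    (l • (1 + (r - 1) • P)) ^ m = l ^ m • (1 + (r ^ m - 1) • P) := by
  induction m with
  | zero => simp
  | succ m ih =>
    rw [pow_succ, ih, Matrix.smul_mul, Matrix.mul_smul, smul_smul, ← pow_succ]
    congr 1
    simp only [mul_add, add_mul, mul_one, one_mul, Matrix.mul_smul, Matrix.smul_mul, smul_smul, hP]
    module

theorem Matrix.exists_idempotent_of_pow_eq_one {A : Matrix (Fin 2) (Fin 2) ℂ} {n : ℕ}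
    (hn : 0 < n) (hA : A ^ n = 1) (hs : ∀ c : ℂ, A ≠ c • (1 : Matrix (Fin 2) (Fin 2) ℂ)) :
    ∃ (P : Matrix (Fin 2) (Fin 2) ℂ) (l r : ℂ), l ≠ 0 ∧ r ≠ 1 ∧ r ^ n = 1 ∧
      P * P = P ∧ P.trace = 1 ∧ A = l • (1 + (r - 1) • P) := by
  obtain ⟨d, hd⟩ := IsAlgClosed.exists_pow_nat_eq (A.trace ^ 2 - 4 * A.det) (n := 2) (by norm_num)
  have hdet : A.det ≠ 0 := by
    intro h
    have := congrArg Matrix.det hA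
    simp [Matrix.det_pow, h, hn.ne'] at this
  obtain ⟨l, hl⟩ : ∃ l, l = (A.trace - d) / 2 := ⟨_, rfl⟩
  have htr : A.trace = 2 * l + d := by rw [hl]; ring
  have hdt : A.det = l * (l + d) := by
    rw [htr] at hd; linear_combination hd / 4
  have hl0 : l ≠ 0 := by
    rintro rfl
    simp [hdt] at hdet
  have hNN : (A - l • 1) * (A - l • 1) = d • (A - l • 1) := by
    rw [Matrix.trace_fin_two] at htr
    rw [Matrix.det_fin_two] at hdt
    have h1 : A 1 1 = 2 * l + d - A 0 0 := by linear_combination htr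
    rw [h1] at hdt
    ext i j
    fin_cases i <;> fin_cases j <;>
      simp [Matrix.mul_apply, Fin.sum_univ_two, h1]
    · linear_combination -hdt
    · ring
    · ring
    · linear_combination -hdt
  by_cases hd0 : d = 0
  · exfalso
    subst hd0
    rw [zero_smul] at hNN
    obtain ⟨N, hN⟩ : ∃ N, N = A - l • 1 := ⟨_, rfl⟩
    rw [← hN] at hNN
    have hAN : A = l • 1 + N := by rw [hN]; abel
    have key : ∀ m : ℕ, A ^ (m + 1) = l ^ (m + 1) • 1 + ((m + 1 : ℂ) * l ^ m) • N := by
      intro m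
      induction m with
      | zero => simp [hAN]
      | succ m ih =>
        rw [pow_succ, ih, hAN]
        simp only [mul_add, add_mul, mul_one, one_mul, Matrix.mul_smul, Matrix.smul_mul, smul_smul,
          hNN, smul_zero, add_zero]
        push_cast
        module
    obtain ⟨m, rfl⟩ := Nat.exists_eq_succ_of_ne_zero hn.ne'
    have hk := key m
    rw [hA] at hk
    have hc : ((m + 1 : ℂ) * l ^ m) ≠ 0 :=
      mul_ne_zero (by exact_mod_cast Nat.succ_ne_zero m) (pow_ne_zero _ hl0)
    have hN' : N = (((m + 1 : ℂ) * l ^ m)⁻¹ * (1 - l ^ (m + 1))) • 1 := by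
      rw [mul_smul, eq_inv_smul_iff₀ hc, sub_smul, one_smul]
      exact eq_sub_of_add_eq' hk.symm
    apply hs (l + ((m + 1 : ℂ) * l ^ m)⁻¹ * (1 - l ^ (m + 1)))
    rw [add_smul, ← hN', ← hAN]
  · obtain ⟨P, hPdef⟩ : ∃ P, P = d⁻¹ • (A - l • 1) := ⟨_, rfl⟩
    have hP : P * P = P := by
      rw [hPdef, Matrix.smul_mul, Matrix.mul_smul, hNN, smul_smul d⁻¹ d, inv_mul_cancel₀ hd0,
        one_smul]
    have hPt : P.trace = 1 := by
      rw [hPdef, Matrix.trace_smul, Matrix.trace_sub, Matrix.trace_smul, htr]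
      simp
      field_simp
      ring
    have hAP : A = l • (1 + ((l + d) / l - 1) • P) := by
      have : l • (1 + ((l + d) / l - 1) • P) = l • 1 + d • P := by
        rw [smul_add, smul_smul]
        congr 2
        field_simp
        ring
      rw [this, hPdef, smul_smul, mul_inv_cancel₀ hd0, one_smul]
      abel
    refine ⟨P, l, (l + d) / l, hl0, ?_, ?_, hP, hPt, hAP⟩
    · rw [Ne, div_eq_one_iff_eq hl0]
      simpa using hd0
    · have hpow := Matrix.smul_one_add_smul_pow hP l ((l + d) / l) n
      rw [← hAP, hA] at hpow
      have h1 := congrArg Matrix.trace hpow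
      have h2 := congrArg (fun X => Matrix.trace (X * P)) hpow
      simp [add_mul, hP, hPt, Matrix.trace_add, Matrix.trace_smul] at h1 h2
      have h3 : l ^ n = 1 := by linear_combination h2 - h1
      rw [h3] at h2
      linear_combination -h2

theorem matPairIrreducible_trace_ne_one {A B P Q : Matrix (Fin 2) (Fin 2) ℂ} {l s : ℂ}
    (hP : P * P = P) (hPt : P.trace = 1) (hQ : Q * Q = Q) (hQt : Q.trace = 1)
    (hA : A = l • (1 + s • P)) (hB : B = l • (1 + s • Q)) (hirr : MatPairIrreducible A B) :
    (P * Q).trace ≠ 1 := by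
  intro hc
  have inv : ∀ (W : Submodule ℂ (Fin 2 → ℂ)) (R : Matrix (Fin 2) (Fin 2) ℂ),
      (∀ v ∈ W, R.mulVec v ∈ W) → ∀ v ∈ W, (l • (1 + s • R)).mulVec v ∈ W := by
    intro W R h v hv
    rw [Matrix.smul_mulVec, Matrix.add_mulVec, Matrix.one_mulVec, Matrix.smul_mulVec]
    exact W.smul_mem _ (W.add_mem hv (W.smul_mem _ (h v hv)))
  have red : ∀ N : Matrix (Fin 2) (Fin 2) ℂ, N ≠ 0 → N.det = 0 →
      (∀ v, N.mulVec v = 0 → N.mulVec (P.mulVec v) = 0) →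
      (∀ v, N.mulVec v = 0 → N.mulVec (Q.mulVec v) = 0) → False := by
    intro N hN hdet h1 h2
    rcases hirr (LinearMap.ker N.mulVecLin)
      (by rw [hA]; exact inv _ P fun v hv => h1 v hv)
      (by rw [hB]; exact inv _ Q fun v hv => h2 v hv) with h | h
    · obtain ⟨v, hv, hv0⟩ := Matrix.exists_mulVec_eq_zero_iff.mpr hdet
      have : v ∈ LinearMap.ker N.mulVecLin := hv0
      rw [h] at this
      exact hv this
    · rw [LinearMap.ker_eq_top] at h
      apply hN
      ext i j
      have := congrFun (LinearMap.congr_fun h (Pi.single j 1)) i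
      simpa using this
  have hPQP := Matrix.mul_mul_self_of_idempotent_trace_one hP hPt Q
  have hQPQ := Matrix.mul_mul_self_of_idempotent_trace_one hQ hQt P
  rw [Matrix.trace_mul_comm Q P, hc, one_smul] at hQPQ
  rw [hc, one_smul] at hPQP
  by_cases hPQ : P = Q
  · subst hPQ
    refine red P ?_ ?_ ?_ ?_
    · rintro rfl
      simp at hPt
    · by_contra hdet
      have hu : IsUnit P := (Matrix.isUnit_iff_isUnit_det _).mpr (Ne.isUnit hdet)
      have h1 : P = 1 := hu.mul_left_cancel (by rw [hP, mul_one])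
      rw [h1] at hPt
      norm_num at hPt
    all_goals
      intro v hv
      rw [hv, Matrix.mulVec_zero]
  · have h1 : (P - Q) * P = (1 - P) * (P - Q) + (P - Q) * (P - Q) := by
      simp only [mul_sub, sub_mul, one_mul, hP, hQ]
      abel
    have h2 : (P - Q) * Q = (1 - P) * (P - Q) := by
      simp only [mul_sub, sub_mul, one_mul, hP, hQ]
      abel
    refine red (P - Q) (sub_ne_zero.mpr hPQ) ?_ ?_ ?_
    · have e : P * (P - Q) * P = 0 := by
        simp only [mul_sub, sub_mul, hP, hPQP, sub_self]
      have e2 : (P - Q) * (P - Q) * P = 0 := by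
        simp only [mul_sub, sub_mul, mul_assoc, hP, hQ] at hPQP ⊢
        rw [hPQP]
        abel
      have e3 : (P - Q) * (P - Q) * Q = 0 := by
        simp only [mul_sub, sub_mul, mul_assoc, hP, hQ] at hQPQ ⊢
        rw [hQPQ]
        abel
      have e4 : (P - Q) ^ 3 = 0 := by
        rw [pow_succ, pow_two, mul_sub, e2, e3, sub_zero]
      have := congrArg Matrix.det e4
      simpa [Matrix.det_pow] using this
    · intro v hv
      rw [Matrix.mulVec_mulVec, h1, Matrix.add_mulVec, ← Matrix.mulVec_mulVec, hv,
        ← Matrix.mulVec_mulVec, hv]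
      simp
    · intro v hv
      rw [Matrix.mulVec_mulVec, h2, ← Matrix.mulVec_mulVec, hv]
      simp

theorem not_finite_of_mapsTo_one_sub_mul {R : Set ℝ} (hR : R.Finite) {c k₁ k₂ : ℝ}
    (hc : c ∈ R) (hc0 : 0 < c) (hc1 : c ≠ 1) (hk₁ : 0 < k₁) (hk₁' : k₁ ≤ 1) (hk₂ : 1 ≤ k₂)
    (h₁ : ∀ x ∈ R, 1 - k₁ * x * (1 - x) ∈ R) (h₂ : ∀ x ∈ R, 1 - k₂ * x * (1 - x) ∈ R) :
    False := by
  rcases lt_or_gt_of_ne hc1 with h | h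
  · obtain ⟨m, ⟨hmR, hm0, hm1⟩, hmax⟩ :=
      (hR.inter_of_left (Set.Ioo 0 1)).exists_maximal ⟨c, hc, hc0, h⟩
    have hp : 0 < k₁ * m * (1 - m) := mul_pos (mul_pos hk₁ hm0) (sub_pos.mpr hm1)
    have hlt : m < 1 - k₁ * m * (1 - m) := by
      have : 0 < (1 - m) * (1 - k₁ * m) := mul_pos (sub_pos.mpr hm1) (by nlinarith)
      linarith
    have := hmax ⟨h₁ m hmR, hm0.trans hlt, by linarith⟩ hlt.le
    linarith
  · obtain ⟨m, ⟨hmR, hm1⟩, hmax⟩ :=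
      (hR.inter_of_left (Set.Ioi 1)).exists_maximal ⟨c, hc, h⟩
    have hm1 : 1 < m := hm1
    have hlt : m < 1 - k₂ * m * (1 - m) := by
      have : 0 < (m - 1) * (k₂ * m - 1) := mul_pos (sub_pos.mpr hm1) (by nlinarith)
      linarith
    have := hmax ⟨h₂ m hmR, hm1.trans hlt⟩ hlt.le
    linarith

theorem IsPrimitiveRoot.exists_pow_re_ge_half {r : ℂ} {t : ℕ} (h : IsPrimitiveRoot r t)
    (ht : 6 ≤ t) : ∃ m : ℕ, 1 / 2 ≤ (r ^ m).re ∧ (r ^ m).re < 1 := by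
  have : NeZero t := ⟨by omega⟩
  have hz := Complex.isPrimitiveRoot_exp t (by omega)
  obtain ⟨m, -, hm⟩ := h.eq_pow_of_pow_eq_one hz.pow_eq_one
  have htR : (6 : ℝ) ≤ t := by exact_mod_cast ht
  have hre : (r ^ m).re = Real.cos (2 * Real.pi / t) := by
    rw [hm, ← Complex.exp_ofReal_mul_I_re]
    congr 2
    push_cast
    ring
  have hpi := Real.pi_pos
  have hpos : 0 < 2 * Real.pi / t := by positivity
  have hle : 2 * Real.pi / t ≤ Real.pi / 3 := by
    rw [div_le_div_iff₀ (by linarith) (by norm_num)]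
    nlinarith
  refine ⟨m, ?_, ?_⟩
  · rw [hre, ← Real.cos_pi_div_three]
    exact Real.cos_le_cos_of_nonneg_of_le_pi hpos.le (by linarith) hle
  · rw [hre, ← Real.cos_zero]
    exact Real.cos_lt_cos_of_nonneg_of_le_pi le_rfl (by linarith) hpos

theorem IsPrimitiveRoot.exists_pow_re_le_zero {r : ℂ} {t : ℕ} (h : IsPrimitiveRoot r t)
    (ht : 1 < t) : ∃ m : ℕ, (r ^ m).re ≤ 0 := by
  by_contra! hpos
  have hs := congrArg Complex.re (h.geom_sum_eq_zero ht)
  rw [Complex.re_sum, Complex.zero_re] at hs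
  have : 0 < ∑ i ∈ Finset.range t, (r ^ i).re :=
    Finset.sum_pos (fun i _ => hpos i) ⟨0, by simp; omega⟩
  linarith

theorem Complex.two_sub_sub_inv_of_norm_eq_one {z : ℂ} (hz : ‖z‖ = 1) :
    2 - z - z⁻¹ = ((2 - 2 * z.re : ℝ) : ℂ) := by
  rw [Complex.inv_eq_conj hz]
  have := Complex.add_conj z
  push_cast at this ⊢
  linear_combination -this

theorem Matrix.units_conj_idempotent {P : Matrix (Fin 2) (Fin 2) ℂ} (hP : P * P = P)
    (g : (Matrix (Fin 2) (Fin 2) ℂ)ˣ) :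
    (g.val * P * g⁻¹.val) * (g.val * P * g⁻¹.val) = g.val * P * g⁻¹.val := by
  calc _ = g.val * P * (g⁻¹.val * g.val) * P * g⁻¹.val := by simp only [mul_assoc]
    _ = _ := by rw [Units.inv_mul, mul_one, mul_assoc g.val P P, hP]

theorem Matrix.trace_mul_units_conj_of_idempotent {P : Matrix (Fin 2) (Fin 2) ℂ}
    (hP : P * P = P) (hPt : P.trace = 1) {x : (Matrix (Fin 2) (Fin 2) ℂ)ˣ} {l z : ℂ}
    (hl : l ≠ 0) (hz : z ≠ 0) (hx : x.val = l • (1 + (z - 1) • P))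
    (g : (Matrix (Fin 2) (Fin 2) ℂ)ˣ) :
    (P * ((g⁻¹ * x * g).val * P * (g⁻¹ * x * g)⁻¹.val)).trace =
      1 - (2 - z - z⁻¹) * (P * (g.val * P * g⁻¹.val)).trace *
        (1 - (P * (g.val * P * g⁻¹.val)).trace) := by
  have hinv : x⁻¹.val = l⁻¹ • (1 + (z⁻¹ - 1) • P) := by
    apply Units.inv_eq_of_mul_eq_one_right
    rw [hx, Matrix.smul_mul, Matrix.mul_smul, smul_smul, mul_inv_cancel₀ hl, one_smul]
    have h0 : (z⁻¹ - 1) + (z - 1) + (z - 1) * (z⁻¹ - 1) = 0 := by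
      field_simp
      ring
    have e : (1 + (z - 1) • P) * (1 + (z⁻¹ - 1) • P) =
        1 + ((z⁻¹ - 1) + (z - 1) + (z - 1) * (z⁻¹ - 1)) • P := by
      simp only [mul_add, add_mul, mul_one, one_mul, Matrix.mul_smul, Matrix.smul_mul, smul_smul,
        hP]
      module
    rw [e, h0, zero_smul, add_zero]
  have hQ := Matrix.units_conj_idempotent hP g
  have hQt : (g.val * P * g⁻¹.val).trace = 1 := by
    rw [Matrix.trace_mul_comm, ← mul_assoc, Units.inv_mul, one_mul, hPt]
  have e : (P * ((g⁻¹ * x * g).val * P * (g⁻¹ * x * g)⁻¹.val)).trace =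
      ((g.val * P * g⁻¹.val) * (x.val * (g.val * P * g⁻¹.val) * x⁻¹.val)).trace := by
    have e1 : (g.val * P * g⁻¹.val) * (x.val * (g.val * P * g⁻¹.val) * x⁻¹.val) =
        g.val * (P * g⁻¹.val * x.val * g.val * P * g⁻¹.val * x⁻¹.val) := by
      simp only [mul_assoc]
    have e2 : (g⁻¹ * x * g)⁻¹ = g⁻¹ * x⁻¹ * g := by group
    rw [e1, Matrix.trace_mul_comm g.val, e2]
    simp only [Units.val_mul, mul_assoc]
  rw [e]
  generalize g.val * P * g⁻¹.val = Q at hQ hQt ⊢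
  rw [hinv, hx]
  simp only [Matrix.smul_mul, Matrix.mul_smul, smul_smul]
  rw [inv_mul_cancel₀ hl, one_smul, Matrix.trace_mul_conj_of_idempotent hQ hQt]
  field_simp
  ring

theorem stmt13 (A B : Matrix (Fin 2) (Fin 2) ℂ) (hA : IsUnit A) (hB : IsUnit B)
    (hbraid : A * B * A = B * A * B)
    (hirr : MatPairIrreducible A B)
    (hprim : ¬ MatGroupImprimitive (matGenGroup A B))
    (hpo : ∀ t ∈ ({1, 2, 3, 4, 5} : Set ℕ), ∀ c : ℂ,
      A ^ t ≠ c • (1 : Matrix (Fin 2) (Fin 2) ℂ)) :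
    Set.Infinite (matGenGroup A B : Set (Matrix (Fin 2) (Fin 2) ℂ)ˣ) := by
  intro hfin
  obtain ⟨a, rfl⟩ := hA
  obtain ⟨b, rfl⟩ := hB
  have ha : a ∈ matGenGroup (a : Matrix (Fin 2) (Fin 2) ℂ) b :=
    Subgroup.subset_closure (Or.inl rfl)
  have hb : b ∈ matGenGroup (a : Matrix (Fin 2) (Fin 2) ℂ) b :=
    Subgroup.subset_closure (Or.inr rfl)
  obtain ⟨G, hG⟩ : ∃ G, G = matGenGroup (a : Matrix (Fin 2) (Fin 2) ℂ) b := ⟨_, rfl⟩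
  rw [← hG] at hfin ha hb
  have hab : a * b * a = b * a * b := Units.ext (by simpa using hbraid)
  have hfinG : Finite G := hfin
  obtain ⟨n, hn, han⟩ : ∃ n, 0 < n ∧ a ^ n = 1 := by
    obtain ⟨n, hn, h⟩ := (isOfFinOrder_of_finite (⟨a, ha⟩ : G)).exists_pow_eq_one
    exact ⟨n, hn, congrArg Subtype.val h⟩
  obtain ⟨P, l, r, hl0, hr1, hrn, hP, hPt, haP⟩ :=
    Matrix.exists_idempotent_of_pow_eq_one (A := a) hn
      (by rw [← Units.val_pow_eq_pow_val, han, Units.val_one])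
      (fun c => by simpa using hpo 1 (by simp) c)
  have hapow (m : ℕ) := Matrix.smul_one_add_smul_pow hP l r m
  rw [← haP] at hapow
  have ht6 : 6 ≤ orderOf r := by
    by_contra! hlt
    have h0 : 0 < orderOf r := orderOf_pos_iff.mpr (isOfFinOrder_iff_pow_eq_one.mpr ⟨n, hn, hrn⟩)
    refine hpo (orderOf r) ?_ (l ^ orderOf r) ?_
    · simp only [Set.mem_insert_iff, Set.mem_singleton_iff]
      omega
    · rw [hapow, pow_orderOf_eq_one, sub_self, zero_smul, add_zero]
  have hprimr := IsPrimitiveRoot.orderOf r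
  have hnr : ‖r‖ = 1 := Complex.norm_eq_one_of_pow_eq_one hrn hn.ne'
  have hr0 : r ≠ 0 := by
    rintro rfl
    simp at hnr
  -- the idempotents conjugate to `P` under `G` and their pairings with `P`
  let R : Set ℝ := {x | ∃ g ∈ G, (P * (g.val * P * g⁻¹.val)).trace = (x : ℂ)}
  have hRfin : R.Finite := by
    refine (hfin.image fun g => (P * (g.val * P * g⁻¹.val)).trace.re).subset ?_
    rintro x ⟨g, hg, hx⟩
    exact ⟨g, hg, (congrArg Complex.re hx).trans (Complex.ofReal_re x)⟩
  have hstep (m : ℕ) : ∀ x ∈ R, 1 - (2 - 2 * (r ^ m).re) * x * (1 - x) ∈ R := by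
    rintro x ⟨g, hg, hx⟩
    refine ⟨g⁻¹ * a ^ m * g, G.mul_mem (G.mul_mem (G.inv_mem hg) (G.pow_mem ha m)) hg, ?_⟩
    rw [Matrix.trace_mul_units_conj_of_idempotent hP hPt (pow_ne_zero m hl0) (pow_ne_zero m hr0)
      (by rw [Units.val_pow_eq_pow_val, hapow]), hx,
      Complex.two_sub_sub_inv_of_norm_eq_one (by rw [norm_pow, hnr, one_pow])]
    push_cast
    ring
  obtain ⟨Q, hQdef⟩ : ∃ Q, Q = (a * b).val * P * (a * b)⁻¹.val := ⟨_, rfl⟩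
  have hQ : Q * Q = Q := hQdef ▸ Matrix.units_conj_idempotent hP _
  have hQt : Q.trace = 1 := by
    rw [hQdef, Matrix.trace_mul_comm, ← mul_assoc, Units.inv_mul, one_mul, hPt]
  have hbQ : (b : Matrix (Fin 2) (Fin 2) ℂ) = l • (1 + (r - 1) • Q) := by
    have hb' : b = (a * b) * a * (a * b)⁻¹ := by
      rw [eq_mul_inv_iff_mul_eq, ← mul_assoc, ← hab]
    have e : (b : Matrix (Fin 2) (Fin 2) ℂ) =
        (a * b).val * a.val * (a * b)⁻¹.val := by
      rw [← Units.val_mul, ← Units.val_mul, ← hb']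
    rw [e, haP, hQdef]
    simp only [mul_add, add_mul, mul_one, Matrix.mul_smul, Matrix.smul_mul,
      Units.mul_inv]
  have hne1 := matPairIrreducible_trace_ne_one hP hPt hQ hQt haP hbQ hirr
  have hPQ : P - Q ≠ 0 := by
    intro h
    rw [← sub_eq_zero.mp h, hP] at hne1
    exact hne1 hPt
  have hc : (P * Q).trace * ((2 - 2 * r.re : ℝ) : ℂ) = 1 := by
    have hPQP := Matrix.mul_mul_self_of_idempotent_trace_one hP hPt Q
    have hQPQ := Matrix.mul_mul_self_of_idempotent_trace_one hQ hQt P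
    rw [Matrix.trace_mul_comm Q P] at hQPQ
    have h0 : (l ^ 3 * (r - 1) * (r + (r - 1) ^ 2 * (P * Q).trace)) • (P - Q) = 0 := by
      rw [← sub_eq_zero, haP, hbQ] at hbraid
      rw [← hbraid]
      simp only [mul_add, add_mul, mul_one, one_mul, Matrix.mul_smul, Matrix.smul_mul, smul_smul,
        smul_add, hP, hQ, hPQP, hQPQ]
      module
    have h1 := (smul_eq_zero.mp h0).resolve_right hPQ
    have h2 := (mul_eq_zero.mp h1).resolve_left
      (mul_ne_zero (pow_ne_zero _ hl0) (sub_ne_zero.mpr hr1))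
    rw [← Complex.two_sub_sub_inv_of_norm_eq_one hnr]
    field_simp
    linear_combination -h2
  have hre : r.re < 1 := by
    refine lt_of_le_of_ne (hnr ▸ Complex.re_le_norm r) fun h => ?_
    rw [h] at hc
    norm_num at hc
  have hpos : 0 < 2 - 2 * r.re := by linarith
  have hcR : (P * Q).trace = (((2 - 2 * r.re)⁻¹ : ℝ) : ℂ) := by
    rw [Complex.ofReal_inv]
    exact eq_inv_of_mul_eq_one_left hc
  obtain ⟨m₁, hm₁, hm₁'⟩ := hprimr.exists_pow_re_ge_half ht6
  obtain ⟨m₂, hm₂⟩ := hprimr.exists_pow_re_le_zero (by omega)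
  refine not_finite_of_mapsTo_one_sub_mul hRfin (c := (2 - 2 * r.re)⁻¹)
    ⟨a * b, G.mul_mem ha hb, hQdef ▸ hcR⟩ (inv_pos.mpr hpos) ?_ (by linarith) (by linarith)
    (by linarith) (hstep m₁) (hstep m₂)
  intro h
  rw [h, Complex.ofReal_one] at hcR
  exact hne1 hcR
end
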